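/- Under the stated hypotheses, the Orbit 7 (L,K,K) three-term relation holds: A(1+a−e, 1+b−e, 1+c−e, 1+d−e)·A(1−a, e−a, f−a, g−a)·B_4(a,b,c,d,e,f,g)·K(a;b,c,d;e,f,g) − S(e−a)·A(f−a, f−b, f−c, f−d)·A(g−a, g−b, g−c, g−d)·A(a,b,c,d)·A(a, 1+a−e, 1+a−f, 1+a−g)·K(1−a; 1−b, 1−c, 1−d; 2−e, 2−f, 2−g) − C(a,b,c,d,e,f,g)·L(a,b,c,d;e;f,g) = 0. -/

import Mathlib

noncomputable section

open Complex

/-- `Sn x = sin (π x)`. -/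
def Sn (x : ℂ) : ℂ := Complex.sin ((Real.pi : ℂ) * x)

/-- The renormalized Saalschützian series
`F*(a,b,c,d;e,f,g) = ∑ₖ Γ(k+a)Γ(k+b)Γ(k+c)Γ(k+d)/(k!·Γ(k+e)Γ(k+f)Γ(k+g))`. -/
def Fstar (a b c d e f g : ℂ) : ℂ :=
  ∑' k : ℕ, (Complex.Gamma (k + a) * Complex.Gamma (k + b) *
      Complex.Gamma (k + c) * Complex.Gamma (k + d)) /
    ((k.factorial : ℂ) * Complex.Gamma (k + e) * Complex.Gamma (k + f) *
      Complex.Gamma (k + g))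

/-- The function `K(a;b,c,d;e,f,g)`. -/
def Kf (a b c d e f g : ℂ) : ℂ :=
  (Fstar a b c d e f g +
      Fstar a (1 + a - e) (1 + a - f) (1 + a - g) (1 + a - b) (1 + a - c) (1 + a - d)) /
    (Sn a * Complex.Gamma a ^ 2 * Complex.Gamma b * Complex.Gamma c * Complex.Gamma d *
      Complex.Gamma (1 + a - e) * Complex.Gamma (1 + a - f) * Complex.Gamma (1 + a - g))

/-- The function `L(a,b,c,d;e;f,g)`. -/
def Lf (a b c d e f g : ℂ) : ℂ :=
  (Fstar a b c d e f g -
      Fstar (1 + a - e) (1 + b - e) (1 + c - e) (1 + d - e) (2 - e) (1 + f - e) (1 + g - e)) /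
    (Sn e * Complex.Gamma a * Complex.Gamma b * Complex.Gamma c * Complex.Gamma d *
      Complex.Gamma (1 + a - e) * Complex.Gamma (1 + b - e) * Complex.Gamma (1 + c - e) *
      Complex.Gamma (1 + d - e))

/-- `A(x,y,z,t) = 1/(Γ(x)Γ(y)Γ(z)Γ(t))`. -/
def Af (x y z t : ℂ) : ℂ :=
  1 / (Complex.Gamma x * Complex.Gamma y * Complex.Gamma z * Complex.Gamma t)

def B1 (a b c d e f g : ℂ) : ℂ :=
  Sn b * Sn c * (Sn (b - a) * Sn (c - a) * Sn d + Sn (e - a) * Sn (f - a) * Sn (g - a)) /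
    (Real.pi : ℂ) ^ 4

def B2 (a b c d e f g : ℂ) : ℂ :=
  Sn (f - a) * Sn (g - a) *
    (Sn (b - a) * Sn (c - a) * Sn (d - a) + Sn (e - 2 * a) * Sn (f - a) * Sn (g - a)) /
    (Real.pi : ℂ) ^ 4

def B3 (a b c d e f g : ℂ) : ℂ :=
  (Sn f * Sn (f - e) * Sn (g - a) * Sn (g - b) * Sn (g - c) * Sn (g - d) -
      Sn g * Sn (g - e) * Sn (f - a) * Sn (f - b) * Sn (f - c) * Sn (f - d)) /
    ((Real.pi : ℂ) ^ 4 * Sn (f - g))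

def B4 (a b c d e f g : ℂ) : ℂ :=
  Sn (f - a) * Sn (g - a) * (Sn b * Sn c * Sn d + Sn (e - a) * Sn f * Sn g) /
    (Real.pi : ℂ) ^ 4

def B5 (a b c d e f g : ℂ) : ℂ :=
  Sn b * Sn (e - b) *
    (Sn (b - a) * Sn (c - a) * Sn (d - a) + Sn (e - 2 * a) * Sn (f - a) * Sn (g - a)) /
    (Real.pi : ℂ) ^ 4

def Cf (a b c d e f g : ℂ) : ℂ :=
  Sn (e - a) * (Sn b * Sn c * Sn d * B2 a b c d e f g +
      Sn e * Sn (f - a) * Sn (g - a) * B4 a b c d e f g) / (Real.pi : ℂ) ^ 4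

open Filter Topology

theorem ne_neg_nat_add {α : ℂ} (h : ∀ n : ℕ, α ≠ -n) (k : ℕ) : ∀ n : ℕ, (k + α) ≠ -n := by
  intro n hn
  apply h (k + n)
  push_cast
  linear_combination hn

theorem Gamma_nat_add_ne_zero {α : ℂ} (h : ∀ n : ℕ, α ≠ -n) (k : ℕ) :
    Gamma (k + α) ≠ 0 :=
  Gamma_ne_zero (ne_neg_nat_add h k)

theorem Gamma_nat_add_succ {α : ℂ} (h : ∀ n : ℕ, α ≠ -n) (k : ℕ) :
    Gamma (((k + 1 : ℕ) : ℂ) + α) = (k + α) * Gamma (k + α) := by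
  rw [← Gamma_add_one]
  · push_cast; ring_nf
  · intro h0
    exact ne_neg_nat_add h k 0 (by simpa using h0)

theorem Gamma_nat_add_eq_prod {α : ℂ} (h : ∀ n : ℕ, α ≠ -n) (n : ℕ) :
    Gamma (n + α) = Gamma α * ∏ j ∈ Finset.range n, (α + j) := by
  induction n with
  | zero => simp
  | succ n ih => rw [Gamma_nat_add_succ h, ih, Finset.prod_range_succ]; ring

theorem nat_add_one_ne_zero (n : ℕ) : (n : ℂ) + 1 ≠ 0 := Nat.cast_add_one_ne_zero n

theorem tendsto_nat_add_div (α : ℂ) :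
    Tendsto (fun n : ℕ => ((n : ℂ) + α) / (n + 1)) atTop (𝓝 1) := by
  have h1 : Tendsto (fun n : ℕ => 1 + (α - 1) * (1 / ((n : ℂ) + 1))) atTop
      (𝓝 (1 + (α - 1) * 0)) :=
    ((tendsto_one_div_add_atTop_nhds_zero_nat (𝕜 := ℂ)).const_mul _).const_add _
  simp only [mul_zero, add_zero] at h1
  refine h1.congr fun n => ?_
  have := nat_add_one_ne_zero n
  field_simp
  ring

theorem tendsto_Gamma_div_factorial_of_ne {α : ℂ} (h : ∀ n : ℕ, α ≠ -n) :
    Tendsto (fun n : ℕ => Gamma (n + α) / (n.factorial * ((n : ℂ) + 1) ^ (α - 1)))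
      atTop (𝓝 1) := by
  have hΓ : Gamma α ≠ 0 := Gamma_ne_zero h
  have h1 : Tendsto (fun n : ℕ => Gamma α / GammaSeq α (n + 1)) atTop (𝓝 1) := by
    have := (tendsto_const_nhds (x := Gamma α)).div
      ((GammaSeq_tendsto_Gamma α).comp (tendsto_add_atTop_nat 1)) hΓ
    rw [div_self hΓ] at this
    exact this
  have h2 := (h1.div (tendsto_nat_add_div α) one_ne_zero).div
    (tendsto_nat_add_div (α + 1)) one_ne_zero
  simp only [div_one] at h2
  refine h2.congr fun n => ?_
  simp only [Pi.div_apply]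
  have h3 := nat_add_one_ne_zero n
  have h4 : (n : ℂ) + α ≠ 0 := by
    simpa using ne_neg_nat_add h n 0
  have h5 : (n : ℂ) + (α + 1) ≠ 0 := by
    have := ne_neg_nat_add h n 1
    intro h6; apply this; push_cast; linear_combination h6
  have h6 : ((n : ℂ) + 1) ^ (α - 1) ≠ 0 := by simp [cpow_eq_zero_iff, h3]
  have h7 : ((n.factorial : ℕ) : ℂ) ≠ 0 := by exact_mod_cast n.factorial_ne_zero
  have h8 : ((n : ℂ) + 1) ^ α = (n + 1) ^ (α - 1) * (n + 1) := by
    rw [cpow_sub _ _ h3, cpow_one]; field_simp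
  have h9 := Gamma_nat_add_eq_prod h n
  have h10 : (∏ j ∈ Finset.range n, (α + j)) ≠ 0 := by
    intro h0; rw [h0, mul_zero] at h9; exact Gamma_nat_add_ne_zero h n h9
  rw [GammaSeq, Finset.prod_range_succ, Finset.prod_range_succ, h9, Nat.factorial_succ]
  have h11 : α + n ≠ 0 := by rwa [add_comm]
  have h12 : α + (n + 1) ≠ 0 := by intro h; apply h5; linear_combination h
  push_cast
  rw [h8]
  field_simp
  ring

theorem tendsto_Gamma_div_factorial_of_succ {α : ℂ}
    (h : Tendsto (fun n : ℕ => Gamma (n + (α + 1)) / (n.factorial * ((n : ℂ) + 1) ^ (α + 1 - 1)))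
      atTop (𝓝 1)) :
    Tendsto (fun n : ℕ => Gamma (n + α) / (n.factorial * ((n : ℂ) + 1) ^ (α - 1)))
      atTop (𝓝 1) := by
  have h2 := h.div (tendsto_nat_add_div α) one_ne_zero
  simp only [div_one] at h2
  refine h2.congr' ?_
  obtain ⟨N, hN⟩ := exists_nat_gt ‖α‖
  filter_upwards [eventually_ge_atTop N] with n hn
  simp only [Pi.div_apply]
  have h3 := nat_add_one_ne_zero n
  have h4 : (n : ℂ) + α ≠ 0 := by
    intro h0
    have h1 : α = -(n : ℂ) := by linear_combination h0
    rw [h1, norm_neg, norm_natCast] at hN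
    have : (N : ℝ) ≤ n := by exact_mod_cast hn
    linarith
  have h6 : ((n : ℂ) + 1) ^ (α - 1) ≠ 0 := by simp [h3]
  have h7 : ((n.factorial : ℕ) : ℂ) ≠ 0 := by exact_mod_cast n.factorial_ne_zero
  have h8 : ((n : ℂ) + 1) ^ (α + 1 - 1) = (n + 1) ^ (α - 1) * (n + 1) := by
    rw [add_sub_cancel_right, cpow_sub _ _ h3, cpow_one]; field_simp
  rw [h8, ← add_assoc, Gamma_add_one _ h4]
  field_simp

/-- Stirling-type asymptotics `Γ(n + α) ~ n! (n + 1) ^ (α - 1)`. -/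
theorem tendsto_Gamma_div_factorial (α : ℂ) :
    Tendsto (fun n : ℕ => Gamma (n + α) / (n.factorial * ((n : ℂ) + 1) ^ (α - 1)))
      atTop (𝓝 1) := by
  obtain ⟨N, hN⟩ := exists_nat_gt ‖α‖
  have key : ∀ N : ℕ, ∀ α : ℂ, (∀ n : ℕ, α + N ≠ -n) →
      Tendsto (fun n : ℕ => Gamma (n + α) / (n.factorial * ((n : ℂ) + 1) ^ (α - 1)))
        atTop (𝓝 1) := by
    intro N
    induction N with
    | zero => intro α h; exact tendsto_Gamma_div_factorial_of_ne (by simpa using h)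
    | succ N ih =>
      intro α h
      refine tendsto_Gamma_div_factorial_of_succ (ih (α + 1) fun n hn => h n ?_)
      push_cast
      linear_combination hn
  refine key N α fun n hn => ?_
  have h1 : α = -((n + N : ℕ) : ℂ) := by push_cast; linear_combination hn
  rw [h1, norm_neg, norm_natCast] at hN
  push_cast at hN
  have : (0 : ℝ) ≤ n := n.cast_nonneg
  linarith

theorem tendsto_Gamma_div_Gamma (α γ : ℂ) :
    Tendsto (fun n : ℕ => Gamma (n + α) / Gamma (n + γ) / ((n : ℂ) + 1) ^ (α - γ))
      atTop (𝓝 1) := by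
  have h := (tendsto_Gamma_div_factorial α).div (tendsto_Gamma_div_factorial γ) one_ne_zero
  simp only [div_one] at h
  refine h.congr fun n => ?_
  simp only [Pi.div_apply]
  have h3 := nat_add_one_ne_zero n
  have h7 : ((n.factorial : ℕ) : ℂ) ≠ 0 := by exact_mod_cast n.factorial_ne_zero
  have h8 : ((n : ℂ) + 1) ^ (α - γ) = (n + 1) ^ (α - 1) / (n + 1) ^ (γ - 1) := by
    rw [← cpow_sub _ _ h3]; ring_nf
  have h6 : ∀ β : ℂ, ((n : ℂ) + 1) ^ (β - 1) ≠ 0 := fun β => by simp [h3]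
  have := h6 α
  have := h6 γ
  rw [h8]
  rcases eq_or_ne (Gamma (n + γ)) 0 with h0 | h0
  · simp [h0]
  · field_simp

theorem norm_nat_add_one_cpow (n : ℕ) (s : ℂ) : ‖((n : ℂ) + 1) ^ s‖ = ((n : ℝ) + 1) ^ s.re := by
  have := norm_natCast_cpow_of_pos (Nat.succ_pos n) s
  push_cast at this
  exact this

theorem exists_norm_Gamma_div_Gamma_le (α γ : ℂ) :
    ∃ C : ℝ, 0 ≤ C ∧ ∀ n : ℕ, ‖Gamma (n + α) / Gamma (n + γ)‖ ≤ C * ((n : ℝ) + 1) ^ (α - γ).re := by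
  obtain ⟨C, hC⟩ := (tendsto_Gamma_div_Gamma α γ).norm.bddAbove_range
  refine ⟨C, (norm_nonneg _).trans (hC ⟨0, rfl⟩), fun n => ?_⟩
  have h1 := hC ⟨n, rfl⟩
  simp only [norm_div _ (((n : ℂ) + 1) ^ (α - γ)), norm_nat_add_one_cpow] at h1
  rwa [div_le_iff₀ (by positivity)] at h1

/-- `x` is not an integer. -/
def NotInt (x : ℂ) : Prop := ∀ n : ℤ, x ≠ n

namespace NotInt

variable {x y : ℂ}

theorem of_eq_add (h : NotInt x) (n : ℤ) (hy : y = x + n) : NotInt y := by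
  intro m hm
  apply h (m - n)
  push_cast
  linear_combination hm - hy

theorem of_eq_sub (h : NotInt x) (n : ℤ) (hy : y = n - x) : NotInt y := by
  intro m hm
  apply h (n - m)
  push_cast
  linear_combination hy - hm

theorem ne_neg_nat (h : NotInt x) (n : ℕ) : x ≠ -n := by
  intro hn
  exact h (-n) (by push_cast; exact hn)

theorem ne_zero (h : NotInt x) : x ≠ 0 := by simpa using h 0

theorem Gamma_ne_zero (h : NotInt x) : Gamma x ≠ 0 := Complex.Gamma_ne_zero h.ne_neg_nat

theorem Sn_ne_zero (h : NotInt x) : Sn x ≠ 0 := by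
  intro h0
  obtain ⟨k, hk⟩ := Complex.sin_eq_zero_iff.1 h0
  apply h k
  have : (Real.pi : ℂ) ≠ 0 := by exact_mod_cast Real.pi_ne_zero
  apply mul_left_cancel₀ this
  rw [hk, mul_comm]

end NotInt

theorem pi_ne_zero' : (Real.pi : ℂ) ≠ 0 := by exact_mod_cast Real.pi_ne_zero

theorem Sn_add_one (x : ℂ) : Sn (x + 1) = -Sn x := by
  rw [Sn, Sn, mul_add, mul_one, Complex.sin_add_pi]

theorem Sn_sub_one (x : ℂ) : Sn (x - 1) = -Sn x := by
  rw [Sn, Sn, mul_sub, mul_one, Complex.sin_sub_pi]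

theorem Sn_one_sub (x : ℂ) : Sn (1 - x) = Sn x := by
  rw [Sn, Sn, mul_sub, mul_one, Complex.sin_pi_sub]

theorem Sn_sub_nat (x : ℂ) (n : ℕ) : Sn (x - n) = (-1) ^ n * Sn x := by
  induction n with
  | zero => simp
  | succ n ih =>
    have : x - ((n + 1 : ℕ) : ℂ) = x - n - 1 := by push_cast; ring
    rw [this, Sn_sub_one, ih, pow_succ]; ring

theorem Gamma_mul_Gamma_one_sub' (x : ℂ) : Gamma x * Gamma (1 - x) = Real.pi / Sn x :=
  Complex.Gamma_mul_Gamma_one_sub x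

theorem Gamma_sub_nat {x : ℂ} (h : NotInt x) (n : ℕ) :
    Gamma (x - n) = (-1) ^ n * (Real.pi / Sn x) / Gamma (n + (1 - x)) := by
  have h1 := Gamma_mul_Gamma_one_sub' (x - n)
  rw [Sn_sub_nat, show 1 - (x - n) = n + (1 - x) by ring] at h1
  have h2 : Gamma (n + (1 - x)) ≠ 0 :=
    (h.of_eq_sub (n + 1) (by push_cast; ring)).Gamma_ne_zero
  have h3 := h.Sn_ne_zero
  rw [eq_div_iff h2, h1]
  rcases neg_one_pow_eq_or ℂ n with h4 | h4 <;> rw [h4] <;> field_simp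

theorem Gamma_sub_nat_div_Gamma_sub_nat {α γ : ℂ} (hα : NotInt α) (hγ : NotInt γ) (n : ℕ) :
    Gamma (α - n) / Gamma (γ - n) =
      Sn γ / Sn α * (Gamma (n + (1 - γ)) / Gamma (n + (1 - α))) := by
  rw [Gamma_sub_nat hα, Gamma_sub_nat hγ]
  have h1 : Gamma (n + (1 - γ)) ≠ 0 :=
    (hγ.of_eq_sub (n + 1) (by push_cast; ring)).Gamma_ne_zero
  have h2 : Gamma (n + (1 - α)) ≠ 0 :=
    (hα.of_eq_sub (n + 1) (by push_cast; ring)).Gamma_ne_zero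
  have h3 := hα.Sn_ne_zero
  have h4 := hγ.Sn_ne_zero
  have h5 := pi_ne_zero'
  have h6 : ((-1 : ℂ)) ^ n ≠ 0 := pow_ne_zero _ (by norm_num)
  field_simp

theorem tendsto_Gamma_sub_nat_div {α γ : ℂ} (hα : NotInt α) (hγ : NotInt γ) :
    Tendsto (fun n : ℕ => Gamma (α - n) / Gamma (γ - n) / ((n : ℂ) + 1) ^ (α - γ))
      atTop (𝓝 (Sn γ / Sn α)) := by
  have h := (tendsto_Gamma_div_Gamma (1 - γ) (1 - α)).const_mul (Sn γ / Sn α)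
  rw [mul_one] at h
  refine h.congr fun n => ?_
  rw [Gamma_sub_nat_div_Gamma_sub_nat hα hγ]
  ring_nf

theorem exists_norm_Gamma_div_Gamma_int_le {α γ : ℂ} (hα : NotInt α) (hγ : NotInt γ) :
    ∃ C : ℝ, 0 ≤ C ∧ ∀ m : ℤ,
      ‖Gamma (m + α) / Gamma (m + γ)‖ ≤ C * (|(m : ℝ)| + 1) ^ (α - γ).re := by
  obtain ⟨C, hC, h⟩ := exists_norm_Gamma_div_Gamma_le α γ
  obtain ⟨D, hD, h'⟩ := exists_norm_Gamma_div_Gamma_le (1 - γ) (1 - α)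
  refine ⟨C + ‖Sn γ / Sn α‖ * D, by positivity, fun m => ?_⟩
  rw [add_mul]
  obtain ⟨n, rfl | rfl⟩ := m.eq_nat_or_neg
  · have h1 := h n
    have h2 : |((n : ℤ) : ℝ)| = n := by simp
    rw [h2, Int.cast_natCast]
    exact h1.trans (le_add_of_nonneg_right (by positivity))
  · have h1 := h' n
    have h2 : |((-(n : ℤ) : ℤ) : ℝ)| = n := by simp
    have h3 : ∀ x : ℂ, ((-(n : ℤ) : ℤ) : ℂ) + x = x - n := fun x => by push_cast; ring
    rw [h2, h3, h3, Gamma_sub_nat_div_Gamma_sub_nat hα hγ, norm_mul]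
    have h4 : (1 - γ - (1 - α)) = α - γ := by ring
    rw [h4] at h1
    refine le_add_of_nonneg_of_le (by positivity) ?_
    rw [mul_assoc]
    gcongr

theorem summable_int_abs_add_one_rpow {p : ℝ} (hp : p < -1) :
    Summable fun m : ℤ => (|(m : ℝ)| + 1) ^ p := by
  have h : Summable fun n : ℕ => ((n : ℝ) + 1) ^ p := by
    have := (summable_nat_add_iff 1).2 (Real.summable_nat_rpow.2 hp)
    simpa using this
  refine Summable.of_nat_of_neg ?_ ?_ <;> simpa using h

/-- The two-sided Gamma quotient sequence `Γ(m+p)Γ(m+q) / (Γ(m+r)Γ(m+t))`; for `r = 1` it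
vanishes at negative `m`, because Mathlib's `Γ` vanishes at its poles. -/
def gq (p q r t : ℂ) (m : ℤ) : ℂ :=
  Gamma (m + p) * Gamma (m + q) / (Gamma (m + r) * Gamma (m + t))

theorem gq_eq_mul (p q r t : ℂ) (m : ℤ) :
    gq p q r t m = Gamma (m + p) / Gamma (m + r) * (Gamma (m + q) / Gamma (m + t)) := by
  rw [gq, mul_div_mul_comm]

theorem Gamma_neg_nat_add_one (n : ℕ) : Gamma (((-((n + 1 : ℕ) : ℤ) : ℤ) : ℂ) + 1) = 0 := by
  have := Complex.Gamma_neg_nat_eq_zero n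
  rw [← this]
  congr 1
  push_cast
  ring

theorem gq_one_of_neg (α β γ : ℂ) {m : ℤ} (hm : m < 0) : gq α β 1 γ m = 0 := by
  obtain ⟨n, rfl⟩ : ∃ n : ℕ, m = -((n + 1 : ℕ) : ℤ) := ⟨(-m - 1).toNat, by omega⟩
  rw [gq, Gamma_neg_nat_add_one]
  simp

theorem exists_norm_gq_le {p q r t : ℂ} (hp : NotInt p) (hq : NotInt q) (hr : NotInt r)
    (ht : NotInt t) : ∃ C : ℝ, 0 ≤ C ∧ ∀ m : ℤ,
      ‖gq p q r t m‖ ≤ C * (|(m : ℝ)| + 1) ^ (p + q - r - t).re := by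
  obtain ⟨C, hC, h⟩ := exists_norm_Gamma_div_Gamma_int_le hp hr
  obtain ⟨D, hD, h'⟩ := exists_norm_Gamma_div_Gamma_int_le hq ht
  refine ⟨C * D, by positivity, fun m => ?_⟩
  have h0 : (0 : ℝ) < |(m : ℝ)| + 1 := by positivity
  rw [gq_eq_mul, norm_mul, show (p + q - r - t).re = (p - r).re + (q - t).re by
    simp only [sub_re, add_re]; ring, Real.rpow_add h0]
  calc _ ≤ (C * (|(m : ℝ)| + 1) ^ (p - r).re) * (D * (|(m : ℝ)| + 1) ^ (q - t).re) :=
        mul_le_mul (h m) (h' m) (norm_nonneg _) (by positivity)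
    _ = _ := by ring

theorem exists_norm_gq_one_le (α β γ : ℂ) : ∃ C : ℝ, 0 ≤ C ∧ ∀ m : ℤ,
      ‖gq α β 1 γ m‖ ≤ C * (|(m : ℝ)| + 1) ^ (α + β - 1 - γ).re := by
  obtain ⟨C, hC, h⟩ := exists_norm_Gamma_div_Gamma_le α 1
  obtain ⟨D, hD, h'⟩ := exists_norm_Gamma_div_Gamma_le β γ
  refine ⟨C * D, by positivity, fun m => ?_⟩
  have h0 : (0 : ℝ) < |(m : ℝ)| + 1 := by positivity
  rcases lt_or_ge m 0 with hm | hm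
  · rw [gq_one_of_neg _ _ _ hm, norm_zero]
    positivity
  lift m to ℕ using hm
  rw [gq_eq_mul, norm_mul, show (α + β - 1 - γ).re = (α - 1).re + (β - γ).re by
    simp only [sub_re, add_re]; ring, Real.rpow_add h0]
  have h2 : |((m : ℤ) : ℝ)| = m := by simp
  rw [h2, Int.cast_natCast]
  calc _ ≤ (C * ((m : ℝ) + 1) ^ (α - 1).re) * (D * ((m : ℝ) + 1) ^ (β - γ).re) :=
        mul_le_mul (h m) (h' m) (norm_nonneg _) (by positivity)
    _ = _ := by ring

theorem tendsto_gq_add (p q r t : ℂ) (k : ℤ) :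
    Tendsto (fun n : ℕ => gq p q r t (k + n) / ((n : ℂ) + 1) ^ (p + q - r - t)) atTop (𝓝 1) := by
  have h := (tendsto_Gamma_div_Gamma (k + p) (k + r)).mul (tendsto_Gamma_div_Gamma (k + q) (k + t))
  rw [mul_one] at h
  refine h.congr fun n => ?_
  rw [div_mul_div_comm, ← cpow_add _ _ (nat_add_one_ne_zero n), gq_eq_mul]
  have h1 : ∀ x : ℂ, ((k + (n : ℤ) : ℤ) : ℂ) + x = n + (k + x) := fun x => by push_cast; ring
  simp only [h1]
  ring_nf

theorem exists_Sn_int_add (k : ℤ) : ∃ ε : ℂ, ε ≠ 0 ∧ ∀ x, Sn (k + x) = ε * Sn x := by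
  have h0 : ∀ n : ℕ, ((-1) ^ n : ℂ) ≠ 0 := fun n => pow_ne_zero _ (by norm_num)
  obtain ⟨n, rfl | rfl⟩ := k.eq_nat_or_neg
  · refine ⟨((-1) ^ n)⁻¹, inv_ne_zero (h0 n), fun x => ?_⟩
    have h := Sn_sub_nat (n + x) n
    rw [add_sub_cancel_left] at h
    rw [h, Int.cast_natCast, inv_mul_cancel_left₀ (h0 n)]
  · refine ⟨(-1) ^ n, h0 n, fun x => ?_⟩
    rw [← Sn_sub_nat]
    push_cast
    ring_nf

theorem tendsto_gq_sub {p q r t : ℂ} (hp : NotInt p) (hq : NotInt q) (hr : NotInt r)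
    (ht : NotInt t) (k : ℤ) :
    Tendsto (fun n : ℕ => gq p q r t (k + -n) / ((n : ℂ) + 1) ^ (p + q - r - t)) atTop
      (𝓝 (Sn r * Sn t / (Sn p * Sn q))) := by
  have hs : ∀ x y : ℂ, Sn (k + x) / Sn (k + y) = Sn x / Sn y := by
    intro x y
    obtain ⟨ε, hε, h⟩ := exists_Sn_int_add k
    rw [h, h, mul_div_mul_left _ _ hε]
  have hk : ∀ {x : ℂ}, NotInt x → NotInt (k + x) := fun h => h.of_eq_add k (by ring)
  have h := (tendsto_Gamma_sub_nat_div (hk hp) (hk hr)).mul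
    (tendsto_Gamma_sub_nat_div (hk hq) (hk ht))
  rw [hs, hs, div_mul_div_comm] at h
  refine h.congr fun n => ?_
  rw [div_mul_div_comm, ← cpow_add _ _ (nat_add_one_ne_zero n), gq_eq_mul]
  have h1 : ∀ x : ℂ, ((k + -(n : ℤ) : ℤ) : ℂ) + x = (k + x) - n := fun x => by push_cast; ring
  simp only [h1]
  ring_nf

theorem tendsto_gq_one_sub (α β γ : ℂ) (s : ℂ) (k : ℤ) :
    Tendsto (fun n : ℕ => gq α β 1 γ (k + -n) / ((n : ℂ) + 1) ^ s) atTop (𝓝 0) := by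
  refine tendsto_const_nhds.congr' ?_
  filter_upwards [eventually_gt_atTop k.toNat] with n hn
  rw [gq_one_of_neg _ _ _ (by omega), zero_div]

theorem summable_of_norm_le_rpow {w : ℤ → ℂ} {C p : ℝ} (hp : p < -1)
    (h : ∀ m, ‖w m‖ ≤ C * (|(m : ℝ)| + 1) ^ p) : Summable w :=
  Summable.of_norm_bounded ((summable_int_abs_add_one_rpow hp).mul_left C) h

theorem tendsto_tsum_shift {u v : ℤ → ℂ} {δ l : ℂ} {Cu Cv : ℝ} (hδ : 1 < δ.re)
    (hCu : 0 ≤ Cu) (hCv : 0 ≤ Cv)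
    (hv : ∀ m, ‖v m‖ ≤ Cv * (|(m : ℝ)| + 1) ^ (-1 - δ.re))
    (hu : ∀ m, ‖u m‖ ≤ Cu * (|(m : ℝ)| + 1) ^ (δ.re - 1))
    (j : ℕ → ℤ) (hj : ∀ n : ℕ, |j n| = n)
    (hlim : ∀ k : ℤ, Tendsto (fun n : ℕ => u (k + j n) / ((n : ℂ) + 1) ^ (δ - 1)) atTop (𝓝 l)) :
    Tendsto (fun n : ℕ => (∑' k, v k * u (k + j n)) / ((n : ℂ) + 1) ^ (δ - 1)) atTop
      (𝓝 (l * ∑' k, v k)) := by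
  simp only [← tsum_div_const]
  rw [← tsum_mul_left]
  refine tendsto_tsum_of_dominated_convergence
    (bound := fun k : ℤ => Cv * Cu * (|(k : ℝ)| + 1) ^ (-2 : ℝ))
    ((summable_int_abs_add_one_rpow (by norm_num)).mul_left _) ?_ ?_
  · intro k
    have := (hlim k).const_mul (v k)
    rw [mul_comm] at this
    exact this.congr fun n => by ring
  · refine Eventually.of_forall fun n k => ?_
    have h0 : (0 : ℝ) < |(k : ℝ)| + 1 := by positivity
    have h1 : (0 : ℝ) < (n : ℝ) + 1 := by positivity
    rw [norm_div, norm_nat_add_one_cpow, div_le_iff₀ (by positivity), norm_mul, sub_re, one_re]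
    have h2 : |((k + j n : ℤ) : ℝ)| + 1 ≤ (|(k : ℝ)| + 1) * (n + 1) := by
      have h3 : |((j n : ℤ) : ℝ)| = n := by exact_mod_cast congrArg (Int.cast (R := ℝ)) (hj n)
      push_cast
      have h4 := abs_add_le (k : ℝ) (j n)
      rw [h3] at h4
      nlinarith [abs_nonneg (k : ℝ), (Nat.cast_nonneg n : (0 : ℝ) ≤ n)]
    have h5 : ‖u (k + j n)‖ ≤ Cu * ((|(k : ℝ)| + 1) ^ (δ.re - 1) * ((n : ℝ) + 1) ^ (δ.re - 1)) := by
      refine (hu _).trans ?_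
      rw [← Real.mul_rpow h0.le h1.le]
      gcongr
    have h6 : (|(k : ℝ)| + 1) ^ (-2 : ℝ) =
        (|(k : ℝ)| + 1) ^ (-1 - δ.re) * (|(k : ℝ)| + 1) ^ (δ.re - 1) := by
      rw [← Real.rpow_add h0]; ring_nf
    calc _ ≤ (Cv * (|(k : ℝ)| + 1) ^ (-1 - δ.re)) *
          (Cu * ((|(k : ℝ)| + 1) ^ (δ.re - 1) * ((n : ℝ) + 1) ^ (δ.re - 1))) :=
          mul_le_mul (hv k) h5 (norm_nonneg _) (by positivity)
      _ = _ := by rw [h6]; ring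

theorem Fstar_eq_tsum_gq (α β γ p q r t : ℂ) (j : ℤ) :
    Fstar α β (p + j) (q + j) γ (r + j) (t + j) =
      ∑' k : ℤ, gq α β 1 γ k * gq p q r t (k + j) := by
  rw [Fstar, ← (Nat.cast_injective (R := ℤ)).tsum_eq]
  · refine tsum_congr fun k => ?_
    rw [gq, gq, ← Complex.Gamma_nat_eq_factorial]
    push_cast
    ring_nf
  · intro m hm
    by_contra h
    apply hm
    have : m < 0 := by
      by_contra h2
      exact h ⟨m.toNat, by simp; omega⟩
    simp only [gq_one_of_neg _ _ _ this, zero_mul]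

theorem tsum_gq_one (α β γ : ℂ) : ∑' k : ℤ, gq α β 1 γ k =
    ∑' k : ℕ, Gamma (k + α) * Gamma (k + β) / (k.factorial * Gamma (k + γ)) := by
  rw [← (Nat.cast_injective (R := ℤ)).tsum_eq]
  · refine tsum_congr fun k => ?_
    rw [gq, ← Complex.Gamma_nat_eq_factorial]
    push_cast
    ring_nf
  · intro m hm
    by_contra h
    apply hm
    have : m < 0 := by
      by_contra h2
      exact h ⟨m.toNat, by simp; omega⟩
    exact gq_one_of_neg _ _ _ this

theorem summable_gq_one {α β γ : ℂ} (h : 0 < (γ - α - β).re) : Summable (gq α β 1 γ) := by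
  obtain ⟨C, -, hC⟩ := exists_norm_gq_one_le α β γ
  refine summable_of_norm_le_rpow ?_ hC
  simp only [sub_re, add_re, one_re] at h ⊢
  linarith

theorem summable_gauss_term {α β γ : ℂ} (h : 0 < (γ - α - β).re) :
    Summable fun k : ℕ => Gamma (k + α) * Gamma (k + β) / (k.factorial * Gamma (k + γ)) := by
  have := (summable_gq_one h).comp_injective (Nat.cast_injective (R := ℤ))
  refine this.congr fun k => ?_
  simp [gq, ← Complex.Gamma_nat_eq_factorial]

/-- The contiguous relation behind Gauss's summation theorem. -/
theorem gauss_contiguous {α β γ : ℂ} (hα : ∀ n : ℕ, α ≠ -n) (hβ : ∀ n : ℕ, β ≠ -n)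
    (hγ : ∀ n : ℕ, γ ≠ -n) (h : 1 < (γ - α - β).re) :
    (γ - α) * (γ - β) *
        ∑' k : ℕ, Gamma (k + α) * Gamma (k + β) / (k.factorial * Gamma (k + (γ + 1))) =
      (γ - α - β) * ∑' k : ℕ, Gamma (k + α) * Gamma (k + β) / (k.factorial * Gamma (k + γ)) := by
  have hs0 := summable_gauss_term (α := α) (β := β) (γ := γ) (by linarith)
  have hs1 := summable_gauss_term (α := α) (β := β) (γ := γ + 1) (by
    simp only [sub_re, add_re, one_re] at h ⊢; linarith)
  have hs2 : Summable fun k : ℕ => Gamma ((k + 1 : ℕ) + α) * Gamma ((k + 1 : ℕ) + β) /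
      (k.factorial * Gamma ((k + 1 : ℕ) + γ)) := by
    have := summable_gauss_term (α := α + 1) (β := β + 1) (γ := γ + 1) (by
      simp only [sub_re, add_re, one_re] at h ⊢; linarith)
    refine this.congr fun k => ?_
    push_cast
    ring_nf
  have hG : Summable fun k : ℕ => (k : ℂ) * (Gamma (k + α) * Gamma (k + β) /
      (k.factorial * Gamma (k + γ))) := by
    refine (summable_nat_add_iff 1).1 (hs2.congr fun k => ?_)
    have h1 := nat_add_one_ne_zero k
    rw [Nat.factorial_succ]
    push_cast
    field_simp
  have htel := hG.tsum_eq_zero_add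
  rw [Nat.cast_zero, zero_mul, zero_add] at htel
  rw [← tsum_mul_left, ← tsum_mul_left, ← sub_eq_zero, ← (hs1.mul_left _).tsum_sub (hs0.mul_left _)]
  have hG' := (summable_nat_add_iff 1).2 hG
  have hz := hG'.tsum_sub hG
  rw [← htel, sub_self] at hz
  rw [← hz]
  refine tsum_congr fun k => ?_
  have h1 := nat_add_one_ne_zero k
  have h2 := Gamma_nat_add_succ hα k
  have h3 := Gamma_nat_add_succ hβ k
  have h4 := Gamma_nat_add_succ hγ k
  have h5 : Gamma (k + (γ + 1)) = (k + γ) * Gamma (k + γ) := by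
    rw [← h4]; push_cast; ring_nf
  have h6 : (k : ℂ) + γ ≠ 0 := by simpa using ne_neg_nat_add hγ k 0
  have h7 := Gamma_nat_add_ne_zero hγ k
  have h8 : ((k.factorial : ℕ) : ℂ) ≠ 0 := by exact_mod_cast k.factorial_ne_zero
  rw [h2, h3, h4, h5, Nat.factorial_succ]
  push_cast
  field_simp
  ring

theorem norm_Gamma_div_Gamma_shift_le {γ : ℂ} (hγ : 0 < γ.re) (N k : ℕ) :
    ‖Gamma (N + γ) / Gamma (k + (N + γ))‖ ≤ ‖Gamma γ / Gamma (k + γ)‖ := by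
  have hne : ∀ x : ℂ, 0 < x.re → ∀ n : ℕ, x ≠ -n := by
    intro x hx n hn
    rw [hn] at hx
    simp only [neg_re, natCast_re] at hx
    linarith [(Nat.cast_nonneg n : (0 : ℝ) ≤ n)]
  have hN : 0 < (N + γ).re := by
    simp only [add_re, natCast_re]; positivity
  induction k with
  | zero =>
    simp [Gamma_ne_zero (hne _ hγ), Gamma_ne_zero (hne _ hN)]
  | succ k ih =>
    rw [Gamma_nat_add_succ (hne _ hN), Gamma_nat_add_succ (hne _ hγ), mul_comm (_ + _), ← div_div,
      mul_comm (_ + _), ← div_div, norm_div (_ / _), norm_div (_ / _)]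
    have h1 : 0 < ‖(k : ℂ) + γ‖ := by
      rw [norm_pos_iff]; simpa using ne_neg_nat_add (hne _ hγ) k 0
    have h2 : ‖(k : ℂ) + γ‖ ≤ ‖(k : ℂ) + (N + γ)‖ := by
      refine (sq_le_sq₀ (norm_nonneg _) (norm_nonneg _)).1 ?_
      rw [Complex.sq_norm, Complex.sq_norm, normSq_apply, normSq_apply]
      simp only [add_re, natCast_re, add_im, natCast_im]
      have : (0 : ℝ) ≤ k := k.cast_nonneg
      have : (0 : ℝ) ≤ N := N.cast_nonneg
      nlinarith
    exact div_le_div₀ (norm_nonneg _) ih h1 h2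

/-- Gauss's summation theorem. -/
theorem gauss_sum {α β γ : ℂ} (hα : ∀ n : ℕ, α ≠ -n) (hβ : ∀ n : ℕ, β ≠ -n)
    (hγ : ∀ n : ℕ, γ ≠ -n) (hγα : ∀ n : ℕ, γ - α ≠ -n) (hγβ : ∀ n : ℕ, γ - β ≠ -n)
    (h : 1 < (γ - α - β).re) :
    ∑' k : ℕ, Gamma (k + α) * Gamma (k + β) / (k.factorial * Gamma (k + γ)) =
      Gamma α * Gamma β * Gamma (γ - α - β) / (Gamma (γ - α) * Gamma (γ - β)) := by
  set S : ℂ → ℂ := fun γ => ∑' k : ℕ, Gamma (k + α) * Gamma (k + β) / (k.factorial * Gamma (k + γ))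
    with hS
  have hδ : ∀ n : ℕ, γ - α - β ≠ -n := by
    intro n hn
    rw [hn] at h
    simp only [neg_re, natCast_re] at h
    linarith [(Nat.cast_nonneg n : (0 : ℝ) ≤ n)]
  have hstep : ∀ N : ℕ, S (N + γ) * (Gamma (N + (γ - α)) * Gamma (N + (γ - β))) /
      Gamma (N + (γ - α - β)) = S γ * (Gamma (γ - α) * Gamma (γ - β)) / Gamma (γ - α - β) := by
    intro N
    induction N with
    | zero => simp
    | succ N ih =>
      rw [← ih, Gamma_nat_add_succ hγα, Gamma_nat_add_succ hγβ, Gamma_nat_add_succ hδ]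
      have h1 := gauss_contiguous hα hβ (ne_neg_nat_add hγ N) (by
        simp only [sub_re, add_re, natCast_re] at h ⊢
        linarith [(Nat.cast_nonneg N : (0 : ℝ) ≤ N)])
      have h2 : ((N + 1 : ℕ) : ℂ) + γ = N + γ + 1 := by push_cast; ring
      change _ * S (N + γ + 1) = _ * S (N + γ) at h1
      have h3 : (N : ℂ) + (γ - α - β) ≠ 0 := by simpa using ne_neg_nat_add hδ N 0
      have h4 := Gamma_nat_add_ne_zero hδ N
      rw [h2]
      field_simp
      linear_combination Gamma (N + (γ - α)) * Gamma (N + (γ - β)) * h1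
  have hlim : ∀ᶠ M : ℕ in atTop, Tendsto (fun N : ℕ => S (N + (M + γ)) * Gamma (N + (M + γ))) atTop
      (𝓝 (Gamma α * Gamma β)) := by
    obtain ⟨M₀, hM₀⟩ := exists_nat_gt (-γ.re)
    filter_upwards [eventually_ge_atTop M₀] with M hM
    have hM' : (M₀ : ℝ) ≤ M := by exact_mod_cast hM
    have hre : 0 < (M + γ).re := by simp only [add_re, natCast_re]; linarith
    have hsum := (summable_gauss_term (α := α) (β := β) (γ := M + γ) (by
      simp only [sub_re, add_re, natCast_re] at h ⊢
      linarith [(Nat.cast_nonneg M : (0 : ℝ) ≤ M)])).norm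
    have ht := tendsto_tsum_of_dominated_convergence (𝓕 := atTop)
      (f := fun (N k : ℕ) => Gamma (k + α) * Gamma (k + β) / k.factorial *
        (Gamma (N + (M + γ)) / Gamma (k + (N + (M + γ)))))
      (g := fun k : ℕ => if k = 0 then Gamma α * Gamma β else 0)
      (hsum.mul_left ‖Gamma (M + γ)‖) ?_ ?_
    · rw [tsum_ite_eq] at ht
      refine ht.congr fun N => ?_
      rw [hS]
      simp only
      rw [← tsum_mul_right]
      exact tsum_congr fun k => by ring
    · intro k
      rcases Nat.eq_zero_or_pos k with rfl | hk
      · simp only [if_true]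
        refine tendsto_const_nhds.congr fun N => ?_
        have := Gamma_nat_add_ne_zero (ne_neg_nat_add hγ M) N
        simp [div_self this]
      · rw [if_neg hk.ne']
        have h1 := tendsto_Gamma_div_Gamma (M + γ) (k + (M + γ))
        have h2 : Tendsto (fun N : ℕ => ((N : ℂ) + 1) ^ (M + γ - (k + (M + γ)))) atTop (𝓝 0) := by
          have h3 := (tendsto_one_div_add_atTop_nhds_zero_nat (𝕜 := ℂ)).pow k
          rw [zero_pow hk.ne'] at h3
          refine h3.congr fun N => ?_
          rw [show (M + γ - (k + (M + γ))) = -(k : ℂ) by ring, cpow_neg, cpow_natCast, one_div,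
            inv_pow]
        have h3 := (h1.mul h2).const_mul (Gamma (k + α) * Gamma (k + β) / k.factorial)
        rw [mul_zero, mul_zero] at h3
        refine h3.congr fun N => ?_
        have h4 : ((N : ℂ) + 1) ^ (M + γ - (k + (M + γ))) ≠ 0 := by
          rw [Ne, cpow_eq_zero_iff]
          exact fun h => nat_add_one_ne_zero N h.1
        rw [div_mul_cancel₀ _ h4]
        ring_nf
    · refine Eventually.of_forall fun N k => ?_
      have h1 := norm_Gamma_div_Gamma_shift_le hre N k
      rw [norm_mul]
      calc _ ≤ ‖Gamma (k + α) * Gamma (k + β) / k.factorial‖ * ‖Gamma (M + γ) / Gamma (k + (M + γ))‖ :=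
            mul_le_mul_of_nonneg_left h1 (norm_nonneg _)
        _ = _ := by rw [← norm_mul, ← norm_mul]; ring_nf
  obtain ⟨M, hM⟩ := hlim.exists
  have h1 := (tendsto_Gamma_div_Gamma (M + (γ - α)) (M + (γ - α - β))).mul
    (tendsto_Gamma_div_Gamma (M + (γ - β)) (M + γ))
  have h2 := hM.mul h1
  rw [mul_one, mul_one] at h2
  have h3 : Tendsto (fun _ : ℕ => S γ * (Gamma (γ - α) * Gamma (γ - β)) / Gamma (γ - α - β)) atTop
      (𝓝 (Gamma α * Gamma β)) := by
    refine h2.congr fun N => ?_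
    rw [← hstep (N + M)]
    rw [div_mul_div_comm, ← cpow_add _ _ (nat_add_one_ne_zero N)]
    have h4 : (M + (γ - α) - (M + (γ - α - β)) + (M + (γ - β) - (M + γ))) = (0 : ℂ) := by ring
    rw [h4, cpow_zero, div_one]
    have h5 : ∀ x : ℂ, ((N + M : ℕ) : ℂ) + x = N + (M + x) := fun x => by push_cast; ring
    simp only [h5]
    have := Gamma_nat_add_ne_zero (ne_neg_nat_add hγ M) N
    have := Gamma_nat_add_ne_zero (ne_neg_nat_add hδ M) N
    field_simp
  have h4 := tendsto_nhds_unique tendsto_const_nhds h3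
  have := Gamma_ne_zero hγα
  have := Gamma_ne_zero hγβ
  have := Gamma_ne_zero hδ
  change S γ = _
  field_simp at h4 ⊢
  linear_combination h4

/-- Partial fraction coefficients of `Γ(s) / Γ(s + η)`. -/
def pfCoeff (η : ℂ) (k : ℕ) : ℂ := Gamma (k + (1 - η)) / (k.factorial * (Gamma η * Gamma (1 - η)))

theorem summable_norm_pfCoeff {η : ℂ} (hη : 1 < η.re) : Summable fun k => ‖pfCoeff η k‖ := by
  obtain ⟨C, -, hC⟩ := exists_norm_Gamma_div_Gamma_le (1 - η) 1
  have h : Summable fun n : ℕ => C * ((n : ℝ) + 1) ^ (-η.re) := by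
    have := (summable_nat_add_iff 1).2 (Real.summable_nat_rpow.2 (show -η.re < -1 by linarith))
    exact Summable.mul_left _ (by simpa using this)
  have h' : Summable fun k : ℕ => ‖Gamma (k + (1 - η)) / k.factorial‖ := by
    refine Summable.of_nonneg_of_le (fun _ => norm_nonneg _) (fun k => ?_) h
    have := hC k
    rw [Complex.Gamma_nat_eq_factorial] at this
    simpa using this
  refine (h'.mul_right ‖(Gamma η * Gamma (1 - η))⁻¹‖).congr fun k => ?_
  rw [← norm_mul, pfCoeff, ← div_div, div_eq_mul_inv _ (Gamma η * _)]

theorem tsum_pfCoeff_div {s η : ℂ} (hs : NotInt s) (hη : NotInt η) (hsη : NotInt (s + η))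
    (h : 1 < η.re) : ∑' k : ℕ, pfCoeff η k / (s + k) = Gamma s / Gamma (s + η) := by
  have h1 := gauss_sum (α := s) (β := 1 - η) (γ := s + 1) hs.ne_neg_nat
    (hη.of_eq_sub 1 (by push_cast; ring)).ne_neg_nat (hs.of_eq_add 1 (by push_cast; ring)).ne_neg_nat
    (by
      rw [add_sub_cancel_left]
      intro n hn
      have : ((1 + n : ℕ) : ℂ) = 0 := by push_cast; linear_combination hn
      rw [Nat.cast_eq_zero] at this
      omega)
    (by rw [show s + 1 - (1 - η) = s + η by ring]; exact hsη.ne_neg_nat)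
    (by rw [show s + 1 - s - (1 - η) = η by ring]; exact h)
  rw [show s + 1 - s - (1 - η) = η by ring, show s + 1 - (1 - η) = s + η by ring,
    add_sub_cancel_left, Gamma_one, one_mul] at h1
  have hη0 := hη.Gamma_ne_zero
  have hη1 := (hη.of_eq_sub (y := 1 - η) 1 (by push_cast; ring)).Gamma_ne_zero
  have h2 : Gamma s / Gamma (s + η) =
      (Gamma s * Gamma (1 - η) * Gamma η / Gamma (s + η)) / (Gamma η * Gamma (1 - η)) := by
    field_simp
  rw [h2, ← h1, ← tsum_div_const]
  refine tsum_congr fun k => ?_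
  have hk : NotInt (k + s) := hs.of_eq_add k (by push_cast; ring)
  rw [pfCoeff, ← add_assoc, Gamma_add_one _ hk.ne_zero]
  have := hk.Gamma_ne_zero
  have := hk.ne_zero
  rw [add_comm s k]
  field_simp

theorem summable_norm_inv_sq {x : ℂ} (hx : NotInt x) :
    Summable fun m : ℤ => ‖(x + m)⁻¹‖ ^ 2 := by
  obtain ⟨C, hC, h⟩ := exists_norm_Gamma_div_Gamma_int_le hx
    (hx.of_eq_add (y := x + 1) 1 (by push_cast; ring))
  refine Summable.of_nonneg_of_le (fun _ => by positivity) (fun m => ?_)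
    ((summable_int_abs_add_one_rpow (p := -2) (by norm_num)).mul_left (C ^ 2))
  have hm : NotInt (m + x) := hx.of_eq_add m (by ring)
  have h1 : Gamma (m + x) / Gamma (m + (x + 1)) = (x + m)⁻¹ := by
    rw [← add_assoc, Gamma_add_one _ hm.ne_zero, add_comm x]
    have := hm.Gamma_ne_zero
    have := hm.ne_zero
    field_simp
  have h2 := h m
  have h0 : (0 : ℝ) ≤ |(m : ℝ)| + 1 := by positivity
  rw [h1, show x - (x + 1) = -1 by ring, neg_re, one_re] at h2
  calc _ ≤ (C * (|(m : ℝ)| + 1) ^ (-1 : ℝ)) ^ 2 := by gcongr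
    _ = _ := by rw [mul_pow, ← Real.rpow_mul_natCast h0]; norm_num

theorem norm_mul_inv_le (z w : ℂ) : ‖z⁻¹ * w⁻¹‖ ≤ (‖z⁻¹‖ ^ 2 + ‖w⁻¹‖ ^ 2) / 2 := by
  rw [norm_mul]
  nlinarith [sq_nonneg (‖z⁻¹‖ - ‖w⁻¹‖)]

theorem summable_norm_inv_mul_inv {x y : ℂ} (hx : NotInt x) (hy : NotInt y) :
    Summable fun m : ℤ => ‖(x + m)⁻¹ * (y + m)⁻¹‖ :=
  Summable.of_nonneg_of_le (fun _ => norm_nonneg _) (fun _ => norm_mul_inv_le _ _)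
    (((summable_norm_inv_sq hx).add (summable_norm_inv_sq hy)).div_const 2)

theorem tsum_int_inv_mul_inv {x y : ℂ} (hx : NotInt x) (hy : NotInt y) (hxy : y - x ≠ 0) :
    ∑' m : ℤ, (x + m)⁻¹ * (y + m)⁻¹ = Real.pi * Sn (y - x) / ((y - x) * (Sn x * Sn y)) := by
  have hmem : ∀ {x : ℂ}, NotInt x → x ∈ integerComplement := by
    intro x hx
    rintro ⟨n, hn⟩
    exact hx n hn.symm
  have hsum := (summable_norm_inv_mul_inv hx hy).of_norm
  have hterm : ∀ m : ℤ, (x + m)⁻¹ * (y + m)⁻¹ = (1 / (x + m) - 1 / (y + m)) / (y - x) := by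
    intro m
    have := (hx.of_eq_add (y := x + m) m rfl).ne_zero
    have := (hy.of_eq_add (y := y + m) m rfl).ne_zero
    field_simp
    ring
  have hcx := cot_series_rep' (hmem hx)
  have hcy := cot_series_rep' (hmem hy)
  have hsx : Summable fun n : ℕ => (1 / (x - (n + 1)) + 1 / (x + (n + 1))) :=
    summable_cotTerm (hmem hx)
  have hsy : Summable fun n : ℕ => (1 / (y - (n + 1)) + 1 / (y + (n + 1))) :=
    summable_cotTerm (hmem hy)
  have h1 : ∑' m : ℤ, (x + m)⁻¹ * (y + m)⁻¹ =
      (Real.pi * cot (Real.pi * x) - Real.pi * cot (Real.pi * y)) / (y - x) := by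
    rw [← HasSum.tsum_eq (hsum.hasSum)]
    have h2 := hsum.hasSum.nat_add_neg
    have h3 := h2.tsum_eq
    have h4 := h2.summable.tsum_eq_zero_add
    rw [h3] at h4
    have h5 : ∑' n : ℕ, ((x + ((n + 1 : ℕ) : ℤ))⁻¹ * (y + ((n + 1 : ℕ) : ℤ))⁻¹ +
        (x + (-((n + 1 : ℕ) : ℤ) : ℤ))⁻¹ * (y + (-((n + 1 : ℕ) : ℤ) : ℤ))⁻¹) =
        ((Real.pi * cot (Real.pi * x) - 1 / x) - (Real.pi * cot (Real.pi * y) - 1 / y)) / (y - x) := by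
      rw [hcx, hcy, ← hsx.tsum_sub hsy, ← tsum_div_const]
      refine tsum_congr fun n => ?_
      rw [hterm, hterm]
      push_cast
      rw [← sub_eq_add_neg, ← sub_eq_add_neg]
      ring
    rw [h5] at h4
    have h6 := hterm 0
    simp only [Int.cast_zero, add_zero] at h6
    simp only [Nat.cast_zero, Int.cast_zero, add_zero, neg_zero] at h4
    rw [h6] at h4
    linear_combination h4
  rw [h1]
  have hx0 := hx.Sn_ne_zero
  have hy0 := hy.Sn_ne_zero
  have h7 : Sn (y - x) = Sn y * cos (Real.pi * x) - cos (Real.pi * y) * Sn x := by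
    rw [Sn, mul_sub, Complex.sin_sub]; rfl
  rw [Complex.cot_eq_cos_div_sin, Complex.cot_eq_cos_div_sin, h7]
  change (Real.pi * (_ / Sn x) - Real.pi * (_ / Sn y)) / _ = _
  field_simp

theorem tsum_norm_sq_shift {x : ℂ} (k : ℕ) :
    ∑' m : ℤ, ‖(x + k + m)⁻¹‖ ^ 2 = ∑' m : ℤ, ‖(x + m)⁻¹‖ ^ 2 := by
  rw [← (Equiv.addLeft (k : ℤ)).tsum_eq (fun m : ℤ => ‖(x + m)⁻¹‖ ^ 2)]
  refine tsum_congr fun m => ?_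
  simp [add_assoc]

theorem NotInt.add_nat {x : ℂ} (h : NotInt x) (k : ℕ) : NotInt (x + k) :=
  h.of_eq_add k (by push_cast; ring)

theorem summable_dougall_triple {A B η θ : ℂ} (hA : NotInt A) (hB : NotInt B)
    (hη : 1 < η.re) (hθ : 1 < θ.re) :
    Summable fun x : (ℕ × ℕ) × ℤ => pfCoeff η x.1.1 * pfCoeff θ x.1.2 *
      ((A + x.1.1 + x.2)⁻¹ * (B + x.1.2 + x.2)⁻¹) := by
  apply Summable.of_norm
  rw [summable_prod_of_nonneg (fun _ => norm_nonneg _)]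
  have hab : Summable fun p : ℕ × ℕ => ‖pfCoeff η p.1‖ * ‖pfCoeff θ p.2‖ :=
    (summable_norm_pfCoeff hη).mul_of_nonneg (summable_norm_pfCoeff hθ)
      (fun _ => norm_nonneg _) (fun _ => norm_nonneg _)
  constructor
  · rintro ⟨k, l⟩
    simp only [norm_mul (pfCoeff η k * pfCoeff θ l)]
    exact (summable_norm_inv_mul_inv (hA.add_nat k) (hB.add_nat l)).mul_left _
  · refine Summable.of_nonneg_of_le (fun _ => tsum_nonneg fun _ => norm_nonneg _) ?_
      (hab.mul_right ((∑' m : ℤ, ‖(A + m)⁻¹‖ ^ 2 + ∑' m : ℤ, ‖(B + m)⁻¹‖ ^ 2) / 2))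
    rintro ⟨k, l⟩
    simp only [norm_mul (pfCoeff η k * pfCoeff θ l)]
    rw [tsum_mul_left, norm_mul]
    gcongr
    rw [← tsum_norm_sq_shift (x := A) k, ← tsum_norm_sq_shift (x := B) l,
      ← (summable_norm_inv_sq (hA.add_nat k)).tsum_add (summable_norm_inv_sq (hB.add_nat l)),
      ← tsum_div_const]
    exact (summable_norm_inv_mul_inv (hA.add_nat k) (hB.add_nat l)).tsum_le_tsum
      (fun m => norm_mul_inv_le _ _)
      (((summable_norm_inv_sq (hA.add_nat k)).add (summable_norm_inv_sq (hB.add_nat l))).div_const 2)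

theorem Sn_add_nat (x : ℂ) (n : ℕ) : Sn (x + n) = (-1) ^ n * Sn x := by
  have h := Sn_sub_nat (x + n) n
  rw [add_sub_cancel_right] at h
  rw [h, ← mul_assoc, ← mul_pow]
  simp

theorem summable_norm_pfCoeff_div {s η : ℂ} (hs : NotInt s) (h : 1 < η.re) :
    Summable fun k : ℕ => ‖pfCoeff η k / (s + k)‖ := by
  refine Summable.of_nonneg_of_le (fun _ => norm_nonneg _) (fun k => ?_)
    ((summable_norm_pfCoeff h).mul_right (1 + ∑' m : ℤ, ‖(s + m)⁻¹‖ ^ 2))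
  rw [div_eq_mul_inv, norm_mul]
  gcongr
  have h1 := (summable_norm_inv_sq hs).le_tsum (k : ℤ) (fun _ _ => by positivity)
  rw [Int.cast_natCast] at h1
  nlinarith [sq_nonneg (‖(s + k)⁻¹‖ - 1)]

/-- Dougall's bilateral summation theorem. -/
theorem dougall_sum {A B C D : ℂ} (hA : NotInt A) (hB : NotInt B) (hC : NotInt C) (hD : NotInt D)
    (hBA : NotInt (B - A)) (hCA : NotInt (C - A)) (hCB : NotInt (C - B)) (hDA : NotInt (D - A))
    (hDB : NotInt (D - B)) (h1 : 1 < (C - A).re) (h2 : 1 < (D - B).re) :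
    ∑' m : ℤ, gq A B C D m = Real.pi ^ 2 / (Sn A * Sn B) * (Gamma (C + D - A - B - 1) /
      (Gamma (C - A) * Gamma (D - A) * Gamma (C - B) * Gamma (D - B))) := by
  have htriple := summable_dougall_triple hA hB h1 h2
  have hleft : ∀ m : ℤ, gq A B C D m = ∑' p : ℕ × ℕ, pfCoeff (C - A) p.1 * pfCoeff (D - B) p.2 *
      ((A + p.1 + m)⁻¹ * (B + p.2 + m)⁻¹) := by
    intro m
    have hsA := tsum_pfCoeff_div (s := m + A) (η := C - A) (hA.of_eq_add m (by ring)) hCA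
      (hC.of_eq_add m (by ring)) h1
    have hsB := tsum_pfCoeff_div (s := m + B) (η := D - B) (hB.of_eq_add m (by ring)) hDB
      (hD.of_eq_add m (by ring)) h2
    rw [show m + A + (C - A) = m + C by ring] at hsA
    rw [show m + B + (D - B) = m + D by ring] at hsB
    rw [gq_eq_mul, ← hsA, ← hsB, tsum_mul_tsum_of_summable_norm]
    · refine tsum_congr fun p => ?_
      rw [show A + p.1 + m = m + A + p.1 by ring, show B + p.2 + m = m + B + p.2 by ring]
      ring
    · exact summable_norm_pfCoeff_div (hA.of_eq_add m (by ring)) h1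
    · exact summable_norm_pfCoeff_div (hB.of_eq_add m (by ring)) h2
  have hright : ∀ k l : ℕ, ∑' m : ℤ, pfCoeff (C - A) k * pfCoeff (D - B) l *
      ((A + k + m)⁻¹ * (B + l + m)⁻¹) = Real.pi * Sn (B - A) / (Sn A * Sn B) *
        (pfCoeff (C - A) k * (pfCoeff (D - B) l / (B - A - k + l))) := by
    intro k l
    have hne : NotInt (B + l - (A + k)) := hBA.of_eq_add (l - k) (by push_cast; ring)
    rw [tsum_mul_left, tsum_int_inv_mul_inv (hA.add_nat k) (hB.add_nat l) hne.ne_zero]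
    have e3 : Sn (B + l - (A + k)) = (-1) ^ k * ((-1) ^ l * Sn (B - A)) := by
      rw [show B + l - (A + k) = B - A + l - k by ring, Sn_sub_nat, Sn_add_nat]
    rw [Sn_add_nat, Sn_add_nat, e3]
    have hs : ((-1) ^ k : ℂ) ≠ 0 := pow_ne_zero _ (by norm_num)
    have hs' : ((-1) ^ l : ℂ) ≠ 0 := pow_ne_zero _ (by norm_num)
    have := hA.Sn_ne_zero
    have := hB.Sn_ne_zero
    have h3 := hne.ne_zero
    have h4 : B - A - k + l ≠ 0 := by rwa [show B - A - k + l = B + l - (A + k) by ring]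
    field_simp
    ring
  have hinner : ∀ k : ℕ, ∑' l : ℕ, pfCoeff (C - A) k * (pfCoeff (D - B) l / (B - A - k + l)) =
      Sn (D - A) / Sn (B - A) / (Gamma (C - A) * Gamma (1 - (C - A))) *
        (Gamma (k + (1 - (C - A))) * Gamma (k + (1 - (D - A))) /
          (k.factorial * Gamma (k + (1 - (B - A))))) := by
    intro k
    rw [tsum_mul_left, tsum_pfCoeff_div (hBA.of_eq_add (-k) (by push_cast; ring)) hDB
      (hDA.of_eq_add (-k) (by push_cast; ring)) h2,
      show B - A - k + (D - B) = D - A - k by ring, Gamma_sub_nat_div_Gamma_sub_nat hBA hDA, pfCoeff]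
    ring
  have hsum2 := htriple.prod
  simp only [hright] at hsum2
  have hgauss := gauss_sum (α := 1 - (C - A)) (β := 1 - (D - A)) (γ := 1 - (B - A))
    (hCA.of_eq_sub 1 (by push_cast; ring)).ne_neg_nat
    (hDA.of_eq_sub 1 (by push_cast; ring)).ne_neg_nat
    (hBA.of_eq_sub 1 (by push_cast; ring)).ne_neg_nat
    (hCB.of_eq_add 0 (by push_cast; ring)).ne_neg_nat
    (hDB.of_eq_add 0 (by push_cast; ring)).ne_neg_nat
    (by simp only [sub_re, one_re] at h1 h2 ⊢; linarith)
  rw [show 1 - (B - A) - (1 - (C - A)) = C - B by ring,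
    show 1 - (B - A) - (1 - (D - A)) = D - B by ring,
    show C - B - (1 - (D - A)) = C + D - A - B - 1 by ring] at hgauss
  simp only [hleft]
  rw [Summable.tsum_comm (f := fun p : ℕ × ℕ => fun m : ℤ =>
    pfCoeff (C - A) p.1 * pfCoeff (D - B) p.2 * ((A + p.1 + m)⁻¹ * (B + p.2 + m)⁻¹)) htriple]
  simp only [hright]
  rw [hsum2.tsum_prod]
  simp only [tsum_mul_left] at hinner ⊢
  simp only [hinner]
  rw [tsum_mul_left, hgauss]
  have e1 := Gamma_mul_Gamma_one_sub' (D - A)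
  have e2 := Gamma_mul_Gamma_one_sub' (C - A)
  have := hDA.Sn_ne_zero
  have := hBA.Sn_ne_zero
  have := hA.Sn_ne_zero
  have := hB.Sn_ne_zero
  have := hCA.Gamma_ne_zero
  have := hDA.Gamma_ne_zero
  have := hCB.Gamma_ne_zero
  have := hDB.Gamma_ne_zero
  have := (hCA.of_eq_sub 1 (y := 1 - (C - A)) (by push_cast; ring)).Gamma_ne_zero
  have e3 : Gamma (1 - (D - A)) = Real.pi / (Sn (D - A) * Gamma (D - A)) := by
    rw [← div_div, ← e1]; field_simp
  rw [e3]
  field_simp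

theorem summable_Fstar {a b c d e f g : ℂ} (h : e + f + g = a + b + c + d + 1) :
    Summable fun k : ℕ => (Gamma (k + a) * Gamma (k + b) * Gamma (k + c) * Gamma (k + d)) /
      ((k.factorial : ℂ) * Gamma (k + e) * Gamma (k + f) * Gamma (k + g)) := by
  obtain ⟨C₁, hC₁, h₁⟩ := exists_norm_Gamma_div_Gamma_le a 1
  obtain ⟨C₂, hC₂, h₂⟩ := exists_norm_Gamma_div_Gamma_le b e
  obtain ⟨C₃, hC₃, h₃⟩ := exists_norm_Gamma_div_Gamma_le c f
  obtain ⟨C₄, hC₄, h₄⟩ := exists_norm_Gamma_div_Gamma_le d g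
  have hs : Summable fun k : ℕ => C₁ * C₂ * C₃ * C₄ * ((k : ℝ) + 1) ^ (-2 : ℝ) := by
    have := (Real.summable_nat_rpow (p := -2)).2 (by norm_num)
    refine Summable.mul_left _ ?_
    have h2 := (summable_nat_add_iff 1).2 this
    simpa using h2
  refine Summable.of_norm_bounded hs fun k => ?_
  have h0 : (0 : ℝ) < (k : ℝ) + 1 := by positivity
  have hre : (-2 : ℝ) = (a - 1).re + (b - e).re + (c - f).re + (d - g).re := by
    have := congrArg re h
    simp only [add_re, sub_re, one_re] at this ⊢
    linarith
  have hk : (Gamma (k + a) * Gamma (k + b) * Gamma (k + c) * Gamma (k + d)) /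
      ((k.factorial : ℂ) * Gamma (k + e) * Gamma (k + f) * Gamma (k + g)) =
      Gamma (k + a) / Gamma (k + 1) * (Gamma (k + b) / Gamma (k + e)) *
        (Gamma (k + c) / Gamma (k + f)) * (Gamma (k + d) / Gamma (k + g)) := by
    rw [Complex.Gamma_nat_eq_factorial, div_mul_div_comm, div_mul_div_comm, div_mul_div_comm]
  rw [hk, norm_mul, norm_mul, norm_mul, hre, Real.rpow_add h0, Real.rpow_add h0, Real.rpow_add h0]
  calc _ ≤ (C₁ * ((k : ℝ) + 1) ^ (a - 1).re) * (C₂ * ((k : ℝ) + 1) ^ (b - e).re) *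
        (C₃ * ((k : ℝ) + 1) ^ (c - f).re) * (C₄ * ((k : ℝ) + 1) ^ (d - g).re) := by
        gcongr
        exacts [h₁ k, h₂ k, h₃ k, h₄ k]
    _ = _ := by ring

theorem Fstar_rec {a b c d e f g : ℂ} (h : e + f + g = a + b + c + d + 1) (ha : NotInt a)
    (hb : NotInt b) (hc : NotInt c) (hd : NotInt d) (he : NotInt e) (hf : NotInt f)
    (hg : NotInt g) :
    c * (e - 1 - c) * Fstar a b c d e f g +
      (f - d) * (c + d + 1 - e) * Fstar a b (c + 1) d e (f + 1) g +
      (a - g) * (b - g) * Fstar a b (c + 1) (d + 1) e (f + 1) (g + 1) = 1 := by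
  have s₁ := (summable_Fstar h).hasSum.mul_left (c * (e - 1 - c))
  have s₂ := (summable_Fstar (a := a) (b := b) (c := c + 1) (d := d) (e := e) (f := f + 1)
    (g := g) (by linear_combination h)).hasSum.mul_left ((f - d) * (c + d + 1 - e))
  have s₃ := (summable_Fstar (a := a) (b := b) (c := c + 1) (d := d + 1) (e := e) (f := f + 1)
    (g := g + 1) (by linear_combination h)).hasSum.mul_left ((a - g) * (b - g))
  have s := ((s₁.add s₂).add s₃).tendsto_sum_nat
  refine tendsto_nhds_unique s ?_
  clear s s₁ s₂ s₃
  set H : ℕ → ℂ := fun n => n * (Gamma (n + a) * Gamma (n + b) * Gamma (n + c) * Gamma (n + d)) /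
      ((n.factorial : ℂ) * Gamma (n + (e - 1)) * Gamma (n + f) * Gamma (n + g)) with hH
  have he' : NotInt (e - 1) := he.of_eq_add (-1) (by push_cast; ring)
  have hsucc : ∀ n : ℕ, H (n + 1) = Gamma (n + (1 + a)) / Gamma (n + 1) *
      (Gamma (n + (1 + b)) / Gamma (n + e)) * (Gamma (n + (1 + c)) / Gamma (n + (1 + f))) *
        (Gamma (n + (1 + d)) / Gamma (n + (1 + g))) := by
    intro n
    have e1 : ((n + 1 : ℕ) : ℂ) + (e - 1) = n + e := by push_cast; ring
    have e2 : ∀ x : ℂ, ((n + 1 : ℕ) : ℂ) + x = n + (1 + x) := fun x => by push_cast; ring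
    have e3 : ((n + 1 : ℕ) : ℂ) ≠ 0 := by exact_mod_cast n.succ_ne_zero
    simp only [hH, e1]
    rw [Complex.Gamma_nat_eq_factorial, div_mul_div_comm, div_mul_div_comm, div_mul_div_comm,
      Nat.factorial_succ, Nat.cast_mul, mul_assoc ((n + 1 : ℕ) : ℂ), mul_assoc ((n + 1 : ℕ) : ℂ),
      mul_assoc ((n + 1 : ℕ) : ℂ), mul_div_mul_left _ _ e3]
    simp only [e2]
  have hlim : Tendsto H atTop (𝓝 1) := by
    rw [← tendsto_add_atTop_iff_nat 1]
    have t := (((tendsto_Gamma_div_Gamma (1 + a) 1).mul (tendsto_Gamma_div_Gamma (1 + b) e)).mul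
      (tendsto_Gamma_div_Gamma (1 + c) (1 + f))).mul (tendsto_Gamma_div_Gamma (1 + d) (1 + g))
    simp only [mul_one] at t
    refine t.congr fun n => ?_
    rw [hsucc]
    have hx := nat_add_one_ne_zero n
    have hz : ((n : ℂ) + 1) ^ (1 + a - 1) * ((n : ℂ) + 1) ^ (1 + b - e) *
        ((n : ℂ) + 1) ^ (1 + c - (1 + f)) * ((n : ℂ) + 1) ^ (1 + d - (1 + g)) = 1 := by
      rw [← cpow_add _ _ hx, ← cpow_add _ _ hx, ← cpow_add _ _ hx,
        show 1 + a - 1 + (1 + b - e) + (1 + c - (1 + f)) + (1 + d - (1 + g)) = 0 by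
          linear_combination -h, cpow_zero]
    rw [div_mul_div_comm, div_mul_div_comm, div_mul_div_comm, hz, div_one]
  have h0 : H 0 = 0 := by simp [hH]
  have hstep : ∀ k : ℕ, c * (e - 1 - c) * (Gamma (k + a) * Gamma (k + b) * Gamma (k + c) *
      Gamma (k + d) / ((k.factorial : ℂ) * Gamma (k + e) * Gamma (k + f) * Gamma (k + g))) +
      (f - d) * (c + d + 1 - e) * (Gamma (k + a) * Gamma (k + b) * Gamma (k + (c + 1)) *
      Gamma (k + d) / ((k.factorial : ℂ) * Gamma (k + e) * Gamma (k + (f + 1)) * Gamma (k + g))) +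
      (a - g) * (b - g) * (Gamma (k + a) * Gamma (k + b) * Gamma (k + (c + 1)) *
      Gamma (k + (d + 1)) / ((k.factorial : ℂ) * Gamma (k + e) * Gamma (k + (f + 1)) *
      Gamma (k + (g + 1)))) = H (k + 1) - H k := by
    intro k
    have G : ∀ {x : ℂ}, NotInt x → Gamma (k + (x + 1)) = (k + x) * Gamma (k + x) := fun hx => by
      rw [← Gamma_nat_add_succ hx.ne_neg_nat k]; push_cast; ring_nf
    have N : ∀ {x : ℂ}, NotInt x → (k : ℂ) + x ≠ 0 :=
      fun hx => (hx.of_eq_add k (by push_cast; ring)).ne_zero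
    have N' : ∀ {x : ℂ}, NotInt x → Gamma ((k : ℂ) + x) ≠ 0 :=
      fun hx => (hx.of_eq_add k (by push_cast; ring)).Gamma_ne_zero
    have hE : Gamma (k + e) = (k + (e - 1)) * Gamma (k + (e - 1)) := by
      rw [← G he']; ring_nf
    have hk : (k.factorial : ℂ) ≠ 0 := by exact_mod_cast k.factorial_ne_zero
    rw [hsucc, Complex.Gamma_nat_eq_factorial]
    simp only [hH, add_comm (1 : ℂ)]
    rw [G ha, G hb, G hc, G hd, G hf, G hg, hE]
    have hf0 := N hf
    have hg0 := N hg
    have he0 := N he'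
    have hf1 := N' hf
    have hg1 := N' hg
    have he1 := N' he'
    field_simp
    rw [show g = a + b + c + d + 1 - e - f by linear_combination h]
    ring
  simp only [hstep, Finset.sum_range_sub, h0, sub_zero]
  exact hlim

/-- No entry of `v` and no difference of two entries of `v` is an integer. -/
def Generic (v : Fin 7 → ℂ) : Prop :=
  (∀ i, NotInt (v i)) ∧ ∀ i j, i ≠ j → NotInt (v i - v j)

namespace Generic

variable {v : Fin 7 → ℂ} {a b c d e f g : ℂ}

theorem add (h : Generic v) (n : Fin 7 → ℤ) {w : Fin 7 → ℂ} (hw : ∀ i, w i = v i + n i) :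
    Generic w := by
  refine ⟨fun i => (h.1 i).of_eq_add (n i) (hw i), fun i j hij =>
    (h.2 i j hij).of_eq_add (n i - n j) ?_⟩
  rw [hw, hw]
  push_cast
  ring

theorem sub (h : Generic v) (n : Fin 7 → ℤ) {w : Fin 7 → ℂ} (hw : ∀ i, w i = n i - v i) :
    Generic w := by
  refine ⟨fun i => (h.1 i).of_eq_sub (n i) (hw i), fun i j hij =>
    (h.2 i j hij).of_eq_sub (n i - n j) ?_⟩
  rw [hw, hw]
  push_cast
  ring

theorem perm (h : Generic v) (σ : Fin 7 → Fin 7) (hσ : Function.Injective σ) {w : Fin 7 → ℂ}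
    (hw : ∀ i, w i = v (σ i)) : Generic w := by
  refine ⟨fun i => ?_, fun i j hij => ?_⟩
  · rw [hw]
    exact h.1 _
  · rw [hw, hw]
    exact h.2 _ _ (hσ.ne hij)

theorem swap (h : Generic ![a, b, c, d, e, f, g]) : Generic ![a, b, d, c, e, g, f] :=
  h.perm ![0, 1, 3, 2, 4, 6, 5] (by decide) (by intro i; fin_cases i <;> rfl)

theorem rotate (h : Generic ![a, b, c, d, e, f, g]) : Generic ![a, c, d, b, e, g, f] :=
  h.perm ![0, 2, 3, 1, 4, 6, 5] (by decide) (by intro i; fin_cases i <;> rfl)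

theorem shift (h : Generic ![a, b, c, d, e, f, g]) (k l : ℤ) :
    Generic ![a, b, c + k, d + l, e, f + k, g + l] :=
  h.add ![0, 0, k, l, 0, k, l] (by intro i; fin_cases i <;> simp)

theorem reflect (h : Generic ![a, b, c, d, e, f, g]) :
    Generic ![1 - a, 1 - b, -d, -c, 2 - e, 1 - g, 1 - f] :=
  h.swap.sub ![1, 1, 0, 0, 2, 1, 1] (by intro i; fin_cases i <;> simp)

end Generic

theorem Fstar_swap_bc (a b c d e f g : ℂ) : Fstar a b c d e f g = Fstar a c b d e f g :=
  tsum_congr fun k => by ring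

theorem Fstar_swap_cd (a b c d e f g : ℂ) : Fstar a b c d e f g = Fstar a b d c e f g :=
  tsum_congr fun k => by ring

theorem Fstar_swap_ef (a b c d e f g : ℂ) : Fstar a b c d e f g = Fstar a b c d f e g :=
  tsum_congr fun k => by ring

theorem Fstar_swap_fg (a b c d e f g : ℂ) : Fstar a b c d e f g = Fstar a b c d e g f :=
  tsum_congr fun k => by ring

/-- The numerator of `Kf`. -/
def Knum (a b c d e f g : ℂ) : ℂ :=
  Fstar a b c d e f g +
    Fstar a (1 + a - e) (1 + a - f) (1 + a - g) (1 + a - b) (1 + a - c) (1 + a - d)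

/-- The numerator of `Lf`. -/
def Lnum (a b c d e f g : ℂ) : ℂ :=
  Fstar a b c d e f g -
    Fstar (1 + a - e) (1 + b - e) (1 + c - e) (1 + d - e) (2 - e) (1 + f - e) (1 + g - e)

/-- The Gamma factor that makes the reflected numerator satisfy the same recurrence as `Knum`. -/
def reflFactor (a b c d e f g : ℂ) : ℂ :=
  Gamma (1 + b - e) * Gamma (1 + c - e) * Gamma (1 + d - e) /
    (Gamma (1 - b) * Gamma (1 - c) * Gamma (1 - d) *
      (Gamma (f - a) * Gamma (f - b) * Gamma (f - c) * Gamma (f - d)) *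
      (Gamma (g - a) * Gamma (g - b) * Gamma (g - c) * Gamma (g - d)))

/-- The reflected numerator, rescaled by `reflFactor`. -/
def Rnum (a b c d e f g : ℂ) : ℂ :=
  reflFactor a b c d e f g * Knum (1 - a) (1 - b) (1 - c) (1 - d) (2 - e) (2 - f) (2 - g)

theorem Knum_swap (a b c d e f g : ℂ) : Knum a b d c e g f = Knum a b c d e f g := by
  rw [Knum, Knum, Fstar_swap_cd, Fstar_swap_fg,
    Fstar_swap_cd a (1 + a - e) (1 + a - g), Fstar_swap_fg a (1 + a - e) (1 + a - f)]

theorem Knum_rotate (a b c d e f g : ℂ) : Knum a c d b e g f = Knum a b c d e f g := by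
  rw [Knum, Knum, Fstar_swap_cd a c, Fstar_swap_bc a c, Fstar_swap_fg a b,
    Fstar_swap_cd a (1 + a - e) (1 + a - g), Fstar_swap_fg a (1 + a - e) (1 + a - f),
    Fstar_swap_ef a (1 + a - e) (1 + a - f)]

theorem Lnum_swap (a b c d e f g : ℂ) : Lnum a b d c e g f = Lnum a b c d e f g := by
  rw [Lnum, Lnum, Fstar_swap_cd, Fstar_swap_fg,
    Fstar_swap_cd (1 + a - e) _ (1 + d - e), Fstar_swap_fg (1 + a - e) (1 + b - e) (1 + c - e)]

theorem Lnum_rotate (a b c d e f g : ℂ) : Lnum a c d b e g f = Lnum a b c d e f g := by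
  rw [Lnum, Lnum, Fstar_swap_cd a c, Fstar_swap_bc a c, Fstar_swap_fg a b,
    Fstar_swap_cd (1 + a - e) (1 + c - e), Fstar_swap_bc (1 + a - e) (1 + c - e),
    Fstar_swap_fg (1 + a - e) (1 + b - e)]

theorem reflFactor_swap (a b c d e f g : ℂ) :
    reflFactor a b d c e g f = reflFactor a b c d e f g := by
  rw [reflFactor, reflFactor]
  ring

theorem reflFactor_rotate (a b c d e f g : ℂ) :
    reflFactor a c d b e g f = reflFactor a b c d e f g := by
  rw [reflFactor, reflFactor]
  ring

theorem Rnum_swap (a b c d e f g : ℂ) : Rnum a b d c e g f = Rnum a b c d e f g := by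
  rw [Rnum, Rnum, reflFactor_swap, Knum_swap]

theorem Rnum_rotate (a b c d e f g : ℂ) : Rnum a c d b e g f = Rnum a b c d e f g := by
  rw [Rnum, Rnum, reflFactor_rotate, Knum_rotate]

/-- The contiguous relation obtained by raising `(c, f)` and then `(d, g)`. -/
def ContigRel (Y : ℂ → ℂ → ℂ → ℂ → ℂ → ℂ → ℂ → ℂ) (a b c d e f g : ℂ) : Prop :=
  c * (e - 1 - c) * Y a b c d e f g +
      (f - d) * (c + d + 1 - e) * Y a b (c + 1) d e (f + 1) g +
      (a - g) * (b - g) * Y a b (c + 1) (d + 1) e (f + 1) (g + 1) = 0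

section

variable {a b c d e f g : ℂ}

theorem Knum_rec (hs : e + f + g = a + b + c + d + 1) (h : Generic ![a, b, c, d, e, f, g]) :
    ContigRel Knum a b c d e f g := by
  have ha : NotInt a := h.1 0
  have hae : NotInt (a - e) := h.2 0 4 (by decide)
  have haf : NotInt (a - f) := h.2 0 5 (by decide)
  have hag : NotInt (a - g) := h.2 0 6 (by decide)
  have hab : NotInt (a - b) := h.2 0 1 (by decide)
  have hac : NotInt (a - c) := h.2 0 2 (by decide)
  have had : NotInt (a - d) := h.2 0 3 (by decide)
  have h1 := Fstar_rec hs ha (h.1 1) (h.1 2) (h.1 3) (h.1 4) (h.1 5) (h.1 6)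
  have h2 := Fstar_rec (a := a) (b := 1 + a - e) (c := a - g) (d := a - f) (e := 1 + a - b)
    (f := a - d) (g := a - c) (by linear_combination hs) ha
    (hae.of_eq_add 1 (by push_cast; ring)) hag haf (hab.of_eq_add 1 (by push_cast; ring)) had hac
  rw [Fstar_swap_cd a _ (a - g), Fstar_swap_fg _ _ _ _ _ (a - d),
    Fstar_swap_cd a _ (a - g + 1) (a - f), Fstar_swap_fg _ _ _ _ _ (a - d + 1),
    Fstar_swap_cd a _ (a - g + 1) (a - f + 1), Fstar_swap_fg _ _ _ _ _ (a - d + 1) (a - c + 1)]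
    at h2
  simp only [ContigRel, Knum]
  simp only [show ∀ x : ℂ, 1 + a - (x + 1) = a - x from fun x => by ring]
  simp only [show ∀ x : ℂ, a - x + 1 = 1 + a - x from fun x => by ring] at h2
  rw [show f = a + b + c + d + 1 - e - g by linear_combination hs] at h1 h2 ⊢
  linear_combination h1 - h2

theorem Lnum_rec (hs : e + f + g = a + b + c + d + 1) (h : Generic ![a, b, c, d, e, f, g]) :
    ContigRel Lnum a b c d e f g := by
  have hae : NotInt (a - e) := h.2 0 4 (by decide)
  have hbe : NotInt (b - e) := h.2 1 4 (by decide)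
  have hce : NotInt (c - e) := h.2 2 4 (by decide)
  have hde : NotInt (d - e) := h.2 3 4 (by decide)
  have hfe : NotInt (f - e) := h.2 5 4 (by decide)
  have hge : NotInt (g - e) := h.2 6 4 (by decide)
  have he : NotInt e := h.1 4
  have h1 := Fstar_rec hs (h.1 0) (h.1 1) (h.1 2) (h.1 3) (h.1 4) (h.1 5) (h.1 6)
  have h2 := Fstar_rec (a := 1 + a - e) (b := 1 + b - e) (c := 1 + c - e) (d := 1 + d - e)
    (e := 2 - e) (f := 1 + f - e) (g := 1 + g - e) (by linear_combination hs)
    (hae.of_eq_add 1 (by push_cast; ring)) (hbe.of_eq_add 1 (by push_cast; ring))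
    (hce.of_eq_add 1 (by push_cast; ring)) (hde.of_eq_add 1 (by push_cast; ring))
    (he.of_eq_sub 2 (by push_cast; ring))
    (hfe.of_eq_add 1 (by push_cast; ring)) (hge.of_eq_add 1 (by push_cast; ring))
  simp only [ContigRel, Lnum]
  simp only [show ∀ x : ℂ, 1 + x - e + 1 = 1 + (x + 1) - e from fun x => by ring] at h2
  linear_combination h1 - h2

theorem reflFactor_shift (h : Generic ![a, b, c, d, e, f, g]) :
    reflFactor a b (c + 1) d e (f + 1) g * ((f - a) * (f - b) * (f - d)) =
      reflFactor a b c d e f g * (c * (1 + c - e) * (1 + c - g)) := by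
  have hfa : NotInt (f - a) := h.2 5 0 (by decide)
  have hfb : NotInt (f - b) := h.2 5 1 (by decide)
  have hfd : NotInt (f - d) := h.2 5 3 (by decide)
  have hfc : NotInt (f - c) := h.2 5 2 (by decide)
  have hga : NotInt (g - a) := h.2 6 0 (by decide)
  have hgb : NotInt (g - b) := h.2 6 1 (by decide)
  have hgc : NotInt (g - c) := h.2 6 2 (by decide)
  have hgd : NotInt (g - d) := h.2 6 3 (by decide)
  have hce : NotInt (c - e) := h.2 2 4 (by decide)
  have hb : NotInt b := h.1 1
  have hc : NotInt c := h.1 2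
  have hd : NotInt d := h.1 3
  have hc' : NotInt (-c) := hc.of_eq_sub 0 (by push_cast; ring)
  have hce' : NotInt (1 + c - e) := hce.of_eq_add 1 (by push_cast; ring)
  have hgc' : NotInt (g - c - 1) := hgc.of_eq_add (-1) (by push_cast; ring)
  have hb' : NotInt (1 - b) := hb.of_eq_sub 1 (by push_cast; ring)
  have hd' : NotInt (1 - d) := hd.of_eq_sub 1 (by push_cast; ring)
  rw [reflFactor, reflFactor]
  rw [show 1 + (c + 1) - e = 1 + c - e + 1 by ring, Gamma_add_one _ hce'.ne_zero,
    show 1 - (c + 1) = -c by ring, show 1 - c = -c + 1 by ring, Gamma_add_one _ hc'.ne_zero,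
    show f + 1 - a = f - a + 1 by ring, Gamma_add_one _ hfa.ne_zero,
    show f + 1 - b = f - b + 1 by ring, Gamma_add_one _ hfb.ne_zero,
    show f + 1 - d = f - d + 1 by ring, Gamma_add_one _ hfd.ne_zero,
    show f + 1 - (c + 1) = f - c by ring, show g - (c + 1) = g - c - 1 by ring,
    show Gamma (g - c) = (g - c - 1) * Gamma (g - c - 1) by
      rw [← Gamma_add_one _ hgc'.ne_zero, sub_add_cancel]]
  have := hfa.ne_zero
  have := hfb.ne_zero
  have := hfd.ne_zero
  have := hgc'.ne_zero
  have := hc.ne_zero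
  have := hfa.Gamma_ne_zero
  have := hfb.Gamma_ne_zero
  have := hfc.Gamma_ne_zero
  have := hfd.Gamma_ne_zero
  have := hga.Gamma_ne_zero
  have := hgb.Gamma_ne_zero
  have := hgc'.Gamma_ne_zero
  have := hgd.Gamma_ne_zero
  have := hb'.Gamma_ne_zero
  have := hd'.Gamma_ne_zero
  have := hc'.Gamma_ne_zero
  field_simp
  ring

theorem Rnum_rec (hs : e + f + g = a + b + c + d + 1) (h : Generic ![a, b, c, d, e, f, g]) :
    ContigRel Rnum a b c d e f g := by
  have hfa : NotInt (f - a) := h.2 5 0 (by decide)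
  have hfb : NotInt (f - b) := h.2 5 1 (by decide)
  have hgc : NotInt (g - c) := h.2 6 2 (by decide)
  have hgc' : NotInt (g - c - 1) := hgc.of_eq_add (-1) (by push_cast; ring)
  have h1 := Knum_rec (by linear_combination -hs) h.reflect
  rw [ContigRel, ← Knum_swap (1 - a) (1 - b) (-d), ← Knum_swap (1 - a) (1 - b) (-d + 1),
    ← Knum_swap (1 - a) (1 - b) (-d + 1)] at h1
  have h2 := reflFactor_shift h
  have h3 := reflFactor_shift (Generic.swap (by simpa using h.shift 1 0))
  rw [reflFactor_swap a b (c + 1) (d + 1), reflFactor_swap a b (c + 1) d] at h3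
  simp only [ContigRel, Rnum]
  rw [show 1 - (c + 1) = -c by ring, show 1 - (d + 1) = -d by ring,
    show 2 - (f + 1) = 1 - f by ring, show 2 - (g + 1) = 1 - g by ring]
  rw [show -c + 1 = 1 - c by ring, show -d + 1 = 1 - d by ring,
    show 1 - f + 1 = 2 - f by ring, show 1 - g + 1 = 2 - g by ring] at h1
  generalize Knum (1 - a) (1 - b) (1 - c) (1 - d) (2 - e) (2 - f) (2 - g) = k₀ at h1 ⊢
  generalize Knum (1 - a) (1 - b) (-c) (1 - d) (2 - e) (1 - f) (2 - g) = k₁ at h1 ⊢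
  generalize Knum (1 - a) (1 - b) (-c) (-d) (2 - e) (1 - f) (1 - g) = k₂ at h1 ⊢
  have hn : (g - c - 1) * ((f - a) * (f - b)) ≠ 0 :=
    mul_ne_zero hgc'.ne_zero (mul_ne_zero hfa.ne_zero hfb.ne_zero)
  apply mul_left_cancel₀ hn
  linear_combination
    (reflFactor a b c d e f g * c * (1 + c - e) * (1 + c - g)) * h1 +
    ((c + d + 1 - e) * (g - c - 1) * k₁ - d * (1 + d - e) * k₂) * h2 +
    (k₂ * (f - a) * (f - b)) * h3

end

/-- Two interlaced sequences satisfying a three-term recurrence. -/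
def Interlaced (α β γ α' β' γ' : ℤ → ℂ) (U V : ℤ → ℂ) : Prop :=
  ∀ j, α j * U j + β j * V j + γ j * U (j + 1) = 0 ∧
    α' j * V j + β' j * U (j + 1) + γ' j * V (j + 1) = 0

section Interlaced

variable {α β γ α' β' γ' : ℤ → ℂ}

theorem Interlaced.eq_zero {U V : ℤ → ℂ} (h : Interlaced α β γ α' β' γ' U V)
    (hα : ∀ j, α j ≠ 0) (hγ : ∀ j, γ j ≠ 0) (hα' : ∀ j, α' j ≠ 0) (hγ' : ∀ j, γ' j ≠ 0)
    (hU : U 0 = 0) (hV : V 0 = 0) (j : ℤ) : U j = 0 ∧ V j = 0 := by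
  induction j using Int.induction_on with
  | zero => exact ⟨hU, hV⟩
  | succ n ih =>
    obtain ⟨h1, h2⟩ := h n
    have hU1 : U (n + 1) = 0 := by simpa [ih.1, ih.2, hγ n] using h1
    exact ⟨hU1, by simpa [ih.2, hU1, hγ' n] using h2⟩
  | pred n ih =>
    obtain ⟨h1, h2⟩ := h (-n - 1)
    rw [sub_add_cancel] at h1 h2
    have hV1 : V (-n - 1) = 0 := by simpa [ih.1, ih.2, hα' (-n - 1)] using h2
    exact ⟨by simpa [ih.1, hV1, hα (-n - 1)] using h1, hV1⟩

theorem exists_linear_relation (x y : Fin 3 → ℂ) :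
    ∃ p : Fin 3 → ℂ, p ≠ 0 ∧ ∑ i, p i * x i = 0 ∧ ∑ i, p i * y i = 0 := by
  let T : (Fin 3 → ℂ) →ₗ[ℂ] (Fin 2 → ℂ) := Matrix.mulVecLin !![x 0, x 1, x 2; y 0, y 1, y 2]
  have hT : LinearMap.ker T ≠ ⊥ := LinearMap.ker_ne_bot_of_finrank_lt (by simp)
  obtain ⟨p, hp, hp0⟩ := (Submodule.ne_bot_iff _).1 hT
  refine ⟨p, hp0, ?_, ?_⟩
  · have := congrFun (LinearMap.mem_ker.1 hp) 0
    simpa [T, Matrix.mulVec, dotProduct, Fin.sum_univ_three, mul_comm] using this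
  · have := congrFun (LinearMap.mem_ker.1 hp) 1
    simpa [T, Matrix.mulVec, dotProduct, Fin.sum_univ_three, mul_comm] using this

theorem Interlaced.eq_zero_of_tendsto {U V : Fin 3 → ℤ → ℂ}
    (h : ∀ i, Interlaced α β γ α' β' γ' (U i) (V i))
    (hα : ∀ j, α j ≠ 0) (hγ : ∀ j, γ j ≠ 0) (hα' : ∀ j, α' j ≠ 0) (hγ' : ∀ j, γ' j ≠ 0)
    {ω : ℕ → ℂ} {x y : Fin 2 → ℂ}
    (h0 : Tendsto (fun n : ℕ => U 0 n / ω n) atTop (𝓝 (x 0)))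
    (h0' : Tendsto (fun n : ℕ => U 0 (-n) / ω n) atTop (𝓝 (y 0)))
    (h1 : Tendsto (fun n : ℕ => U 1 n / ω n) atTop (𝓝 (x 1)))
    (h1' : Tendsto (fun n : ℕ => U 1 (-n) / ω n) atTop (𝓝 (y 1)))
    (h2 : Tendsto (fun n : ℕ => U 2 n / ω n) atTop (𝓝 0))
    (h2' : Tendsto (fun n : ℕ => U 2 (-n) / ω n) atTop (𝓝 0))
    (hdet : x 0 * y 1 - x 1 * y 0 ≠ 0) : U 2 0 = 0 := by
  obtain ⟨p, hp0, hpU, hpV⟩ := exists_linear_relation (fun i => U i 0) (fun i => V i 0)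
  simp only [Fin.sum_univ_three] at hpU hpV
  have hrel : Interlaced α β γ α' β' γ'
      (fun j => p 0 * U 0 j + p 1 * U 1 j + p 2 * U 2 j)
      (fun j => p 0 * V 0 j + p 1 * V 1 j + p 2 * V 2 j) := by
    intro j
    refine ⟨?_, ?_⟩
    · linear_combination p 0 * (h 0 j).1 + p 1 * (h 1 j).1 + p 2 * (h 2 j).1
    · linear_combination p 0 * (h 0 j).2 + p 1 * (h 1 j).2 + p 2 * (h 2 j).2
  have hz := fun j => (hrel.eq_zero hα hγ hα' hγ' hpU hpV j).1
  have e1 : p 0 * x 0 + p 1 * x 1 + p 2 * 0 = 0 := by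
    refine tendsto_nhds_unique (((h0.const_mul _).add (h1.const_mul _)).add (h2.const_mul _))
      (tendsto_const_nhds.congr fun n => ?_)
    rw [← mul_div_assoc, ← mul_div_assoc, ← mul_div_assoc, ← add_div, ← add_div, hz, zero_div]
  have e2 : p 0 * y 0 + p 1 * y 1 + p 2 * 0 = 0 := by
    refine tendsto_nhds_unique (((h0'.const_mul _).add (h1'.const_mul _)).add (h2'.const_mul _))
      (tendsto_const_nhds.congr fun n => ?_)
    rw [← mul_div_assoc, ← mul_div_assoc, ← mul_div_assoc, ← add_div, ← add_div, hz, zero_div]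
  have hp_zero : p 0 = 0 := by
    apply (mul_eq_zero.1 (_ : p 0 * (x 0 * y 1 - x 1 * y 0) = 0)).resolve_right hdet
    linear_combination y 1 * e1 - x 1 * e2
  have hp_one : p 1 = 0 := by
    apply (mul_eq_zero.1 (_ : p 1 * (x 0 * y 1 - x 1 * y 0) = 0)).resolve_right hdet
    linear_combination x 0 * e2 - y 0 * e1
  have hp_two : p 2 ≠ 0 := by
    intro h2
    apply hp0
    ext i
    fin_cases i
    exacts [hp_zero, hp_one, h2]
  rw [hp_zero, hp_one] at hpU
  simpa [hp_two] using hpU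

end Interlaced

theorem interlaced_of_contigRel {Y : ℂ → ℂ → ℂ → ℂ → ℂ → ℂ → ℂ → ℂ}
    (hswap : ∀ a b c d e f g, Y a b d c e g f = Y a b c d e f g)
    (hrec : ∀ {a b c d e f g : ℂ}, e + f + g = a + b + c + d + 1 →
      Generic ![a, b, c, d, e, f, g] → ContigRel Y a b c d e f g)
    {a b c d e f g : ℂ} (hs : e + f + g = a + b + c + d + 1)
    (h : Generic ![a, b, c, d, e, f, g]) :
    Interlaced (fun j => (c + j) * (e - 1 - (c + j)))
      (fun j => (f + j - (d + j)) * (c + j + (d + j) + 1 - e))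
      (fun j => (a - (g + j)) * (b - (g + j)))
      (fun j => (d + j) * (e - 1 - (d + j)))
      (fun j => (g + j - (c + j + 1)) * (d + j + (c + j + 1) + 1 - e))
      (fun j => (a - (f + j + 1)) * (b - (f + j + 1)))
      (fun j => Y a b (c + j) (d + j) e (f + j) (g + j))
      (fun j => Y a b (c + j + 1) (d + j) e (f + j + 1) (g + j)) := by
  intro j
  have h1 := hrec (by linear_combination hs) (h.shift j j)
  have h2 := hrec (by linear_combination hs) (((h.shift j j).shift 1 0).swap)
  simp only [ContigRel, Int.cast_zero, Int.cast_one, add_zero, Int.cast_add] at h1 h2 ⊢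
  rw [hswap _ _ (c + j + 1) (d + j), hswap _ _ (c + j + 1) (d + j + 1),
    hswap _ _ (c + j + 1 + 1) (d + j + 1)] at h2
  simp only [← add_assoc] at h1 h2 ⊢
  exact ⟨h1, h2⟩

/-- The value of Gauss's sum. -/
def gaussVal (α β γ : ℂ) : ℂ :=
  Gamma α * Gamma β * Gamma (γ - α - β) / (Gamma (γ - α) * Gamma (γ - β))

/-- The value of Dougall's bilateral sum. -/
def dougallVal (A B C D : ℂ) : ℂ :=
  Real.pi ^ 2 / (Sn A * Sn B) * (Gamma (C + D - A - B - 1) /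
    (Gamma (C - A) * Gamma (D - A) * Gamma (C - B) * Gamma (D - B)))

theorem tsum_gq_one_eq_gaussVal {α β γ : ℂ} (hα : NotInt α) (hβ : NotInt β) (hγ : NotInt γ)
    (hγα : NotInt (γ - α)) (hγβ : NotInt (γ - β)) (h : 1 < (γ - α - β).re) :
    ∑' k, gq α β 1 γ k = gaussVal α β γ := by
  rw [tsum_gq_one, gauss_sum hα.ne_neg_nat hβ.ne_neg_nat hγ.ne_neg_nat hγα.ne_neg_nat
    hγβ.ne_neg_nat h, gaussVal]

section

variable {α β γ p q r t δ : ℂ}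

theorem tendsto_Fstar_gauss (hs : γ + r + t = α + β + p + q + 1) (hδ : γ - α - β = δ)
    (h1 : 1 < δ.re) (hα : NotInt α) (hβ : NotInt β) (hγ : NotInt γ)
    (hγα : NotInt (γ - α)) (hγβ : NotInt (γ - β)) (hp : NotInt p) (hq : NotInt q) (hr : NotInt r)
    (ht : NotInt t) (j : ℕ → ℤ) (hj : ∀ n : ℕ, |j n| = n) {l : ℂ}
    (hlim : ∀ k : ℤ, Tendsto (fun n : ℕ => gq p q r t (k + j n) / ((n : ℂ) + 1) ^ (p + q - r - t))
      atTop (𝓝 l)) :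
    Tendsto (fun n : ℕ => Fstar α β (p + j n) (q + j n) γ (r + j n) (t + j n) /
      ((n : ℂ) + 1) ^ (δ - 1)) atTop (𝓝 (l * gaussVal α β γ)) := by
  subst hδ
  obtain ⟨C, hC, hv⟩ := exists_norm_gq_one_le α β γ
  obtain ⟨D, hD, hu⟩ := exists_norm_gq_le hp hq hr ht
  have e : p + q - r - t = γ - α - β - 1 := by linear_combination -hs
  rw [e] at hlim hu
  simp only [Fstar_eq_tsum_gq]
  rw [← tsum_gq_one_eq_gaussVal hα hβ hγ hγα hγβ h1]
  refine tendsto_tsum_shift h1 hD hC (fun m => (hv m).trans_eq ?_) (fun m => (hu m).trans_eq ?_)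
    j hj hlim
  · congr 2
    simp only [sub_re, add_re, one_re]
    ring
  · simp only [sub_re, one_re]

theorem tendsto_Fstar_add (hs : γ + r + t = α + β + p + q + 1) (hδ : γ - α - β = δ)
    (h1 : 1 < δ.re) (hα : NotInt α) (hβ : NotInt β) (hγ : NotInt γ)
    (hγα : NotInt (γ - α)) (hγβ : NotInt (γ - β)) (hp : NotInt p) (hq : NotInt q) (hr : NotInt r)
    (ht : NotInt t) :
    Tendsto (fun n : ℕ => Fstar α β (p + n) (q + n) γ (r + n) (t + n) /
      ((n : ℂ) + 1) ^ (δ - 1)) atTop (𝓝 (gaussVal α β γ)) := by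
  simpa using tendsto_Fstar_gauss hs hδ h1 hα hβ hγ hγα hγβ hp hq hr ht (fun n => n) (by simp)
    (tendsto_gq_add p q r t)

theorem tendsto_Fstar_sub (hs : γ + r + t = α + β + p + q + 1) (hδ : γ - α - β = δ)
    (h1 : 1 < δ.re) (hα : NotInt α) (hβ : NotInt β) (hγ : NotInt γ)
    (hγα : NotInt (γ - α)) (hγβ : NotInt (γ - β)) (hp : NotInt p) (hq : NotInt q) (hr : NotInt r)
    (ht : NotInt t) :
    Tendsto (fun n : ℕ => Fstar α β (p - n) (q - n) γ (r - n) (t - n) /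
      ((n : ℂ) + 1) ^ (δ - 1)) atTop
        (𝓝 (Sn r * Sn t / (Sn p * Sn q) * gaussVal α β γ)) := by
  simpa [← sub_eq_add_neg] using tendsto_Fstar_gauss hs hδ h1 hα hβ hγ hγα hγβ hp hq hr ht
    (fun n => -n) (by simp) (tendsto_gq_sub hp hq hr ht)

theorem tendsto_Fstar_dougall (hs : γ + r + t = α + β + p + q + 1) (hδ : α + β - γ = δ)
    (h1 : 1 < δ.re) (hp : NotInt p) (hq : NotInt q) (hr : NotInt r)
    (ht : NotInt t) (j : ℕ → ℤ) (hj : ∀ n : ℕ, |j n| = n) {l : ℂ}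
    (hlim : ∀ k : ℤ, Tendsto (fun n : ℕ => gq α β 1 γ (k + j n) / ((n : ℂ) + 1) ^ (δ - 1))
      atTop (𝓝 l)) :
    Tendsto (fun n : ℕ => Fstar α β (p - j n) (q - j n) γ (r - j n) (t - j n) /
      ((n : ℂ) + 1) ^ (δ - 1)) atTop (𝓝 (l * ∑' m, gq p q r t m)) := by
  obtain ⟨C, hC, hv⟩ := exists_norm_gq_one_le α β γ
  obtain ⟨D, hD, hu⟩ := exists_norm_gq_le hp hq hr ht
  have e : ∀ n, Fstar α β (p - j n) (q - j n) γ (r - j n) (t - j n) =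
      ∑' m : ℤ, gq p q r t m * gq α β 1 γ (m + j n) := by
    intro n
    have h := Fstar_eq_tsum_gq α β γ p q r t (-j n)
    rw [Int.cast_neg] at h
    simp only [← sub_eq_add_neg] at h
    rw [h, ← (Equiv.addRight (j n)).tsum_eq]
    refine tsum_congr fun m => ?_
    rw [Equiv.coe_addRight, add_sub_cancel_right, mul_comm]
  simp only [e]
  refine tendsto_tsum_shift h1 hC hD (fun m => (hu m).trans_eq ?_) (fun m => (hv m).trans_eq ?_)
    j hj hlim
  · rw [← hδ, show p + q - r - t = -1 - (α + β - γ) by linear_combination -hs]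
    simp only [sub_re, neg_re, one_re]
  · rw [← hδ]
    congr 2
    simp only [sub_re, add_re, one_re]
    ring

theorem tendsto_Fstar_add_dougall (hs : γ + r + t = α + β + p + q + 1) (hδ : α + β - γ = δ)
    (h1 : 1 < δ.re) (hp : NotInt p) (hq : NotInt q) (hr : NotInt r)
    (ht : NotInt t) :
    Tendsto (fun n : ℕ => Fstar α β (p + n) (q + n) γ (r + n) (t + n) /
      ((n : ℂ) + 1) ^ (δ - 1)) atTop (𝓝 0) := by
  simpa using tendsto_Fstar_dougall hs hδ h1 hp hq hr ht (fun n => -n) (by simp)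
    (tendsto_gq_one_sub α β γ (δ - 1))

theorem tendsto_Fstar_sub_dougall (hs : γ + r + t = α + β + p + q + 1) (hδ : α + β - γ = δ)
    (h1 : 1 < δ.re) (hp : NotInt p) (hq : NotInt q) (hr : NotInt r) (ht : NotInt t)
    (hqp : NotInt (q - p)) (hrp : NotInt (r - p)) (hrq : NotInt (r - q)) (htp : NotInt (t - p))
    (htq : NotInt (t - q)) (h2 : 1 < (r - p).re) (h3 : 1 < (t - q).re) :
    Tendsto (fun n : ℕ => Fstar α β (p - n) (q - n) γ (r - n) (t - n) /
      ((n : ℂ) + 1) ^ (δ - 1)) atTop (𝓝 (dougallVal p q r t)) := by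
  rw [dougallVal, ← dougall_sum hp hq hr ht hqp hrp hrq htp htq h2 h3]
  have h := tendsto_gq_add α β 1 γ
  rw [show α + β - 1 - γ = δ - 1 by rw [← hδ]; ring] at h
  simpa using tendsto_Fstar_dougall hs hδ h1 hp hq hr ht (fun n => n) (by simp) h

end

theorem Gamma_one_sub_eq {x : ℂ} (h : NotInt x) : Gamma (1 - x) = Real.pi / (Sn x * Gamma x) := by
  rw [← div_div, ← Gamma_mul_Gamma_one_sub' x, mul_div_cancel_left₀ _ h.Gamma_ne_zero]

section

variable {a b c d e f g : ℂ}

theorem gaussVal_psi (hb : NotInt b) (hea : NotInt (e - a)) :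
    gaussVal a (1 + a - e) (1 + a - b) = Sn b / Sn (e - a) * gaussVal a b e := by
  have h1 := Gamma_one_sub_eq hb
  have h2 := Gamma_one_sub_eq hea
  rw [gaussVal, gaussVal, show 1 + a - b - a = 1 - b by ring,
    show 1 + a - b - (1 + a - e) = e - b by ring, show 1 - b - (1 + a - e) = e - a - b by ring,
    show 1 + a - e = 1 - (e - a) by ring, h1, h2]
  have := hb.Sn_ne_zero
  have := hb.Gamma_ne_zero
  have := hea.Sn_ne_zero
  have := hea.Gamma_ne_zero
  have := pi_ne_zero'
  field_simp

theorem gaussVal_phi (ha : NotInt a) (hb : NotInt b) (hea : NotInt (e - a))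
    (heb : NotInt (e - b)) :
    gaussVal (1 + a - e) (1 + b - e) (2 - e) =
      Sn a * Sn b / (Sn (e - a) * Sn (e - b)) * gaussVal a b e := by
  have h1 := Gamma_one_sub_eq hb
  have h2 := Gamma_one_sub_eq hea
  have h3 := Gamma_one_sub_eq ha
  have h4 := Gamma_one_sub_eq heb
  rw [gaussVal, gaussVal, show 2 - e - (1 + a - e) = 1 - a by ring,
    show 2 - e - (1 + b - e) = 1 - b by ring, show 1 - a - (1 + b - e) = e - a - b by ring,
    show 1 + a - e = 1 - (e - a) by ring, show 1 + b - e = 1 - (e - b) by ring, h1, h2, h3, h4]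
  have := ha.Sn_ne_zero
  have := ha.Gamma_ne_zero
  have := hb.Sn_ne_zero
  have := hb.Gamma_ne_zero
  have := hea.Sn_ne_zero
  have := hea.Gamma_ne_zero
  have := heb.Sn_ne_zero
  have := heb.Gamma_ne_zero
  have := pi_ne_zero'
  field_simp

theorem tendsto_phi_add (hs : e + f + g = a + b + c + d + 1)
    (h : Generic ![a, b, c, d, e, f, g]) (hδ : 1 < (e - a - b).re) :
    Tendsto (fun n : ℕ => Fstar (1 + a - e) (1 + b - e) (1 + (c + n) - e) (1 + (d + n) - e)
      (2 - e) (1 + (f + n) - e) (1 + (g + n) - e) / ((n : ℂ) + 1) ^ (e - a - b - 1)) atTop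
        (𝓝 (Sn a * Sn b / (Sn (e - a) * Sn (e - b)) * gaussVal a b e)) := by
  have ha : NotInt a := h.1 0
  have hb : NotInt b := h.1 1
  have he : NotInt e := h.1 4
  have hea : NotInt (e - a) := h.2 4 0 (by decide)
  have heb : NotInt (e - b) := h.2 4 1 (by decide)
  have hec : NotInt (e - c) := h.2 4 2 (by decide)
  have hed : NotInt (e - d) := h.2 4 3 (by decide)
  have hef : NotInt (e - f) := h.2 4 5 (by decide)
  have heg : NotInt (e - g) := h.2 4 6 (by decide)
  have t := tendsto_Fstar_add (α := 1 + a - e) (β := 1 + b - e) (p := 1 + c - e)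
    (q := 1 + d - e) (γ := 2 - e) (r := 1 + f - e) (t := 1 + g - e) (δ := e - a - b)
    (by linear_combination hs) (by ring) hδ (hea.of_eq_sub 1 (by push_cast; ring))
    (heb.of_eq_sub 1 (by push_cast; ring)) (he.of_eq_sub 2 (by push_cast; ring))
    (ha.of_eq_sub 1 (by push_cast; ring)) (hb.of_eq_sub 1 (by push_cast; ring))
    (hec.of_eq_sub 1 (by push_cast; ring)) (hed.of_eq_sub 1 (by push_cast; ring))
    (hef.of_eq_sub 1 (by push_cast; ring)) (heg.of_eq_sub 1 (by push_cast; ring))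
  rw [gaussVal_phi ha hb hea heb] at t
  refine t.congr fun n => ?_
  simp only [show ∀ x : ℂ, 1 + (x + n) - e = 1 + x - e + n from fun x => by ring]

theorem tendsto_phi_sub (hs : e + f + g = a + b + c + d + 1)
    (h : Generic ![a, b, c, d, e, f, g]) (hδ : 1 < (e - a - b).re) :
    Tendsto (fun n : ℕ => Fstar (1 + a - e) (1 + b - e) (1 + (c - n) - e) (1 + (d - n) - e)
      (2 - e) (1 + (f - n) - e) (1 + (g - n) - e) / ((n : ℂ) + 1) ^ (e - a - b - 1)) atTop
        (𝓝 (Sn (e - f) * Sn (e - g) / (Sn (e - c) * Sn (e - d)) *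
          (Sn a * Sn b / (Sn (e - a) * Sn (e - b)) * gaussVal a b e))) := by
  have ha : NotInt a := h.1 0
  have hb : NotInt b := h.1 1
  have he : NotInt e := h.1 4
  have hea : NotInt (e - a) := h.2 4 0 (by decide)
  have heb : NotInt (e - b) := h.2 4 1 (by decide)
  have hec : NotInt (e - c) := h.2 4 2 (by decide)
  have hed : NotInt (e - d) := h.2 4 3 (by decide)
  have hef : NotInt (e - f) := h.2 4 5 (by decide)
  have heg : NotInt (e - g) := h.2 4 6 (by decide)
  have t := tendsto_Fstar_sub (α := 1 + a - e) (β := 1 + b - e) (p := 1 + c - e)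
    (q := 1 + d - e) (γ := 2 - e) (r := 1 + f - e) (t := 1 + g - e) (δ := e - a - b)
    (by linear_combination hs) (by ring) hδ (hea.of_eq_sub 1 (by push_cast; ring))
    (heb.of_eq_sub 1 (by push_cast; ring)) (he.of_eq_sub 2 (by push_cast; ring))
    (ha.of_eq_sub 1 (by push_cast; ring)) (hb.of_eq_sub 1 (by push_cast; ring))
    (hec.of_eq_sub 1 (by push_cast; ring)) (hed.of_eq_sub 1 (by push_cast; ring))
    (hef.of_eq_sub 1 (by push_cast; ring)) (heg.of_eq_sub 1 (by push_cast; ring))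
  rw [gaussVal_phi ha hb hea heb] at t
  have hsn : ∀ x : ℂ, Sn (1 + x - e) = Sn (e - x) := fun x => by
    rw [← Sn_one_sub]; congr 1; ring
  simp only [hsn] at t
  refine t.congr fun n => ?_
  simp only [show ∀ x : ℂ, 1 + (x - n) - e = 1 + x - e - n from fun x => by ring]

theorem tendsto_psi_add (hs : e + f + g = a + b + c + d + 1)
    (h : Generic ![a, b, c, d, e, f, g]) (hδ : 1 < (e - a - b).re) :
    Tendsto (fun n : ℕ => Fstar a (1 + a - e) (1 + a - (f + n)) (1 + a - (g + n))
      (1 + a - b) (1 + a - (c + n)) (1 + a - (d + n)) / ((n : ℂ) + 1) ^ (e - a - b - 1)) atTop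
        (𝓝 (Sn (c - a) * Sn (d - a) / (Sn (f - a) * Sn (g - a)) *
          (Sn b / Sn (e - a) * gaussVal a b e))) := by
  have ha : NotInt a := h.1 0
  have hb : NotInt b := h.1 1
  have hea : NotInt (e - a) := h.2 4 0 (by decide)
  have heb : NotInt (e - b) := h.2 4 1 (by decide)
  have hba : NotInt (b - a) := h.2 1 0 (by decide)
  have hca : NotInt (c - a) := h.2 2 0 (by decide)
  have hda : NotInt (d - a) := h.2 3 0 (by decide)
  have hfa : NotInt (f - a) := h.2 5 0 (by decide)
  have hga : NotInt (g - a) := h.2 6 0 (by decide)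
  have t := tendsto_Fstar_sub (α := a) (β := 1 + a - e) (p := 1 + a - f) (q := 1 + a - g)
    (γ := 1 + a - b) (r := 1 + a - c) (t := 1 + a - d) (δ := e - a - b)
    (by linear_combination hs) (by ring) hδ ha (hea.of_eq_sub 1 (by push_cast; ring))
    (hba.of_eq_sub 1 (by push_cast; ring)) (hb.of_eq_sub 1 (by push_cast; ring))
    (heb.of_eq_add 0 (by push_cast; ring)) (hfa.of_eq_sub 1 (by push_cast; ring))
    (hga.of_eq_sub 1 (by push_cast; ring)) (hca.of_eq_sub 1 (by push_cast; ring))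
    (hda.of_eq_sub 1 (by push_cast; ring))
  rw [gaussVal_psi hb hea] at t
  have hsn : ∀ x : ℂ, Sn (1 + a - x) = Sn (x - a) := fun x => by
    rw [← Sn_one_sub]; congr 1; ring
  simp only [hsn] at t
  refine t.congr fun n => ?_
  simp only [show ∀ x : ℂ, 1 + a - (x + n) = 1 + a - x - n from fun x => by ring]

theorem tendsto_psi_sub (hs : e + f + g = a + b + c + d + 1)
    (h : Generic ![a, b, c, d, e, f, g]) (hδ : 1 < (e - a - b).re) :
    Tendsto (fun n : ℕ => Fstar a (1 + a - e) (1 + a - (f - n)) (1 + a - (g - n))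
      (1 + a - b) (1 + a - (c - n)) (1 + a - (d - n)) / ((n : ℂ) + 1) ^ (e - a - b - 1)) atTop
        (𝓝 (Sn b / Sn (e - a) * gaussVal a b e)) := by
  have ha : NotInt a := h.1 0
  have hb : NotInt b := h.1 1
  have hea : NotInt (e - a) := h.2 4 0 (by decide)
  have heb : NotInt (e - b) := h.2 4 1 (by decide)
  have hba : NotInt (b - a) := h.2 1 0 (by decide)
  have hca : NotInt (c - a) := h.2 2 0 (by decide)
  have hda : NotInt (d - a) := h.2 3 0 (by decide)
  have hfa : NotInt (f - a) := h.2 5 0 (by decide)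
  have hga : NotInt (g - a) := h.2 6 0 (by decide)
  have t := tendsto_Fstar_add (α := a) (β := 1 + a - e) (p := 1 + a - f) (q := 1 + a - g)
    (γ := 1 + a - b) (r := 1 + a - c) (t := 1 + a - d) (δ := e - a - b)
    (by linear_combination hs) (by ring) hδ ha (hea.of_eq_sub 1 (by push_cast; ring))
    (hba.of_eq_sub 1 (by push_cast; ring)) (hb.of_eq_sub 1 (by push_cast; ring))
    (heb.of_eq_add 0 (by push_cast; ring)) (hfa.of_eq_sub 1 (by push_cast; ring))
    (hga.of_eq_sub 1 (by push_cast; ring)) (hca.of_eq_sub 1 (by push_cast; ring))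
    (hda.of_eq_sub 1 (by push_cast; ring))
  rw [gaussVal_psi hb hea] at t
  refine t.congr fun n => ?_
  simp only [show ∀ x : ℂ, 1 + a - (x - n) = 1 + a - x + n from fun x => by ring]

theorem tendsto_Lnum_add (hs : e + f + g = a + b + c + d + 1)
    (h : Generic ![a, b, c, d, e, f, g]) (hδ : 1 < (e - a - b).re) :
    Tendsto (fun n : ℕ => Lnum a b (c + n) (d + n) e (f + n) (g + n) /
      ((n : ℂ) + 1) ^ (e - a - b - 1)) atTop
        (𝓝 ((1 - Sn a * Sn b / (Sn (e - a) * Sn (e - b))) * gaussVal a b e)) := by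
  have hea : NotInt (e - a) := h.2 4 0 (by decide)
  have heb : NotInt (e - b) := h.2 4 1 (by decide)
  have t := (tendsto_Fstar_add hs rfl hδ (h.1 0) (h.1 1) (h.1 4) hea heb (h.1 2) (h.1 3) (h.1 5)
    (h.1 6)).sub (tendsto_phi_add hs h hδ)
  rw [sub_mul, one_mul]
  exact t.congr fun n => by rw [Lnum, sub_div]

theorem tendsto_Lnum_sub (hs : e + f + g = a + b + c + d + 1)
    (h : Generic ![a, b, c, d, e, f, g]) (hδ : 1 < (e - a - b).re) :
    Tendsto (fun n : ℕ => Lnum a b (c - n) (d - n) e (f - n) (g - n) /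
      ((n : ℂ) + 1) ^ (e - a - b - 1)) atTop
        (𝓝 ((Sn f * Sn g / (Sn c * Sn d) - Sn (e - f) * Sn (e - g) / (Sn (e - c) * Sn (e - d)) *
          (Sn a * Sn b / (Sn (e - a) * Sn (e - b)))) * gaussVal a b e)) := by
  have hea : NotInt (e - a) := h.2 4 0 (by decide)
  have heb : NotInt (e - b) := h.2 4 1 (by decide)
  have t := (tendsto_Fstar_sub hs rfl hδ (h.1 0) (h.1 1) (h.1 4) hea heb (h.1 2) (h.1 3) (h.1 5)
    (h.1 6)).sub (tendsto_phi_sub hs h hδ)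
  rw [sub_mul, mul_assoc _ (Sn a * Sn b / (Sn (e - a) * Sn (e - b)))]
  exact t.congr fun n => by rw [Lnum, sub_div]

theorem tendsto_Knum_sub_Lnum_add (hs : e + f + g = a + b + c + d + 1)
    (h : Generic ![a, b, c, d, e, f, g]) (hδ : 1 < (e - a - b).re) :
    Tendsto (fun n : ℕ => (Knum a b (c + n) (d + n) e (f + n) (g + n) -
      Lnum a b (c + n) (d + n) e (f + n) (g + n)) / ((n : ℂ) + 1) ^ (e - a - b - 1)) atTop
        (𝓝 ((Sn (c - a) * Sn (d - a) / (Sn (f - a) * Sn (g - a)) * (Sn b / Sn (e - a)) +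
          Sn a * Sn b / (Sn (e - a) * Sn (e - b))) * gaussVal a b e)) := by
  have t := (tendsto_psi_add hs h hδ).add (tendsto_phi_add hs h hδ)
  rw [add_mul, mul_assoc _ (Sn b / Sn (e - a))]
  exact t.congr fun n => by rw [Knum, Lnum, ← add_div]; ring

theorem tendsto_Knum_sub_Lnum_sub (hs : e + f + g = a + b + c + d + 1)
    (h : Generic ![a, b, c, d, e, f, g]) (hδ : 1 < (e - a - b).re) :
    Tendsto (fun n : ℕ => (Knum a b (c - n) (d - n) e (f - n) (g - n) -
      Lnum a b (c - n) (d - n) e (f - n) (g - n)) / ((n : ℂ) + 1) ^ (e - a - b - 1)) atTop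
        (𝓝 ((Sn b / Sn (e - a) + Sn (e - f) * Sn (e - g) / (Sn (e - c) * Sn (e - d)) *
          (Sn a * Sn b / (Sn (e - a) * Sn (e - b)))) * gaussVal a b e)) := by
  have t := (tendsto_psi_sub hs h hδ).add (tendsto_phi_sub hs h hδ)
  rw [add_mul, mul_assoc _ (Sn a * Sn b / (Sn (e - a) * Sn (e - b)))]
  exact t.congr fun n => by rw [Knum, Lnum, ← add_div]; ring

end

theorem Sn_add_int_mul (x y : ℂ) (j : ℤ) : Sn (x + j) * Sn (y + j) = Sn x * Sn y := by
  have h2 : ∀ n : ℕ, ((-1 : ℂ) ^ n) ^ 2 = 1 := fun n => by rw [← pow_mul, mul_comm, pow_mul]; simp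
  obtain ⟨n, rfl | rfl⟩ := j.eq_nat_or_neg
  · rw [Int.cast_natCast, Sn_add_nat, Sn_add_nat]
    linear_combination Sn x * Sn y * h2 n
  · rw [Int.cast_neg, Int.cast_natCast, ← sub_eq_add_neg, ← sub_eq_add_neg, Sn_sub_nat, Sn_sub_nat]
    linear_combination Sn x * Sn y * h2 n

section

variable {a b c d e f g : ℂ}

/-- The part of `reflFactor` that does not change under simultaneous shifts of `c, d, f, g`. -/
def reflConst (b c d e f g : ℂ) : ℂ :=
  Gamma (1 + b - e) * (Sn c * Sn d) / (Real.pi ^ 2 * Gamma (1 - b) *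
    (Gamma (f - c) * Gamma (f - d) * Gamma (g - c) * Gamma (g - d)))

theorem reflFactor_add_int (h : Generic ![a, b, c, d, e, f, g]) (j : ℤ) :
    reflFactor a b (c + j) (d + j) e (f + j) (g + j) = reflConst b c d e f g *
      (gq c (1 + c - e) (f - a) (f - b) j * gq d (1 + d - e) (g - a) (g - b) j) := by
  have hc : NotInt (c + j) := (h.shift j j).1 2
  have hd : NotInt (d + j) := (h.shift j j).1 3
  have hsn := Sn_add_int_mul c d j
  rw [reflFactor, reflConst, ← hsn, gq, gq, Gamma_one_sub_eq hc, Gamma_one_sub_eq hd,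
    show 1 + (c + j) - e = j + (1 + c - e) by ring, show 1 + (d + j) - e = j + (1 + d - e) by ring,
    show f + j - a = j + (f - a) by ring, show f + j - b = j + (f - b) by ring,
    show g + j - a = j + (g - a) by ring, show g + j - b = j + (g - b) by ring,
    add_sub_add_right_eq_sub, add_sub_add_right_eq_sub, add_sub_add_right_eq_sub,
    add_sub_add_right_eq_sub, add_comm c, add_comm d]
  rw [add_comm] at hc hd
  have h1 := hc.Sn_ne_zero
  have h2 := hd.Sn_ne_zero
  have h3 := hc.Gamma_ne_zero
  have h4 := hd.Gamma_ne_zero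
  have h5 := pi_ne_zero'
  clear hsn hc hd
  generalize Gamma (j + (1 + c - e)) = x₁
  generalize Gamma (j + (1 + d - e)) = x₂
  generalize Gamma (j + (f - a)) = x₃
  generalize Gamma (j + (f - b)) = x₄
  generalize Gamma (j + (g - a)) = x₅
  generalize Gamma (j + (g - b)) = x₆
  generalize Gamma (j + c) = x₇ at *
  generalize Gamma (j + d) = x₈ at *
  generalize Sn (j + c) = x₉ at *
  generalize Sn (j + d) = y at *
  generalize (Real.pi : ℂ) = z at *
  simp only [div_eq_mul_inv, mul_inv, inv_inv]
  ring

theorem tendsto_reflFactor_add (hs : e + f + g = a + b + c + d + 1)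
    (h : Generic ![a, b, c, d, e, f, g]) :
    Tendsto (fun n : ℕ => reflFactor a b (c + n) (d + n) e (f + n) (g + n)) atTop
      (𝓝 (reflConst b c d e f g)) := by
  have t := ((tendsto_gq_add c (1 + c - e) (f - a) (f - b) 0).mul
    (tendsto_gq_add d (1 + d - e) (g - a) (g - b) 0)).const_mul (reflConst b c d e f g)
  rw [mul_one, mul_one] at t
  refine t.congr fun n => ?_
  have h1 := reflFactor_add_int h n
  rw [Int.cast_natCast] at h1
  rw [h1, div_mul_div_comm, ← cpow_add _ _ (nat_add_one_ne_zero n), zero_add,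
    show c + (1 + c - e) - (f - a) - (f - b) + (d + (1 + d - e) - (g - a) - (g - b)) = 0 by
      linear_combination -2 * hs, cpow_zero, div_one]

theorem tendsto_reflFactor_sub (hs : e + f + g = a + b + c + d + 1)
    (h : Generic ![a, b, c, d, e, f, g]) :
    Tendsto (fun n : ℕ => reflFactor a b (c - n) (d - n) e (f - n) (g - n)) atTop
      (𝓝 (reflConst b c d e f g * (Sn (f - a) * Sn (f - b) / (Sn c * Sn (e - c)) *
        (Sn (g - a) * Sn (g - b) / (Sn d * Sn (e - d)))))) := by
  have hc : NotInt c := h.1 2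
  have hd : NotInt d := h.1 3
  have hec : NotInt (e - c) := h.2 4 2 (by decide)
  have hed : NotInt (e - d) := h.2 4 3 (by decide)
  have hfa : NotInt (f - a) := h.2 5 0 (by decide)
  have hfb : NotInt (f - b) := h.2 5 1 (by decide)
  have hga : NotInt (g - a) := h.2 6 0 (by decide)
  have hgb : NotInt (g - b) := h.2 6 1 (by decide)
  have t := ((tendsto_gq_sub hc (q := 1 + c - e) (hec.of_eq_sub 1 (by push_cast; ring)) hfa hfb
    0).mul (tendsto_gq_sub hd (q := 1 + d - e) (hed.of_eq_sub 1 (by push_cast; ring)) hga hgb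
    0)).const_mul (reflConst b c d e f g)
  have hsn : ∀ x : ℂ, Sn (1 + x - e) = Sn (e - x) := fun x => by
    rw [← Sn_one_sub]; congr 1; ring
  rw [hsn, hsn] at t
  refine t.congr fun n => ?_
  have h1 := reflFactor_add_int h (-n)
  rw [Int.cast_neg, Int.cast_natCast] at h1
  simp only [← sub_eq_add_neg] at h1
  rw [h1, div_mul_div_comm, ← cpow_add _ _ (nat_add_one_ne_zero n), zero_add,
    show c + (1 + c - e) - (f - a) - (f - b) + (d + (1 + d - e) - (g - a) - (g - b)) = 0 by
      linear_combination -2 * hs, cpow_zero, div_one]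

theorem tendsto_Knum_reflect_add (hs : e + f + g = a + b + c + d + 1)
    (h : Generic ![a, b, c, d, e, f, g]) (hfc : 0 < (c - f).re) (hgd : 0 < (d - g).re) :
    Tendsto (fun n : ℕ => Knum (1 - a) (1 - b) (1 - (c + n)) (1 - (d + n)) (2 - e) (2 - (f + n))
      (2 - (g + n)) / ((n : ℂ) + 1) ^ (e - a - b - 1)) atTop
        (𝓝 (dougallVal (1 - c) (1 - d) (2 - f) (2 - g))) := by
  have hδ : 1 < (e - a - b).re := by
    rw [show e - a - b = 1 + (c - f) + (d - g) by linear_combination hs]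
    simp only [add_re, one_re]
    linarith
  have hc : NotInt c := h.1 2
  have hd : NotInt d := h.1 3
  have hf : NotInt f := h.1 5
  have hg : NotInt g := h.1 6
  have hcd : NotInt (c - d) := h.2 2 3 (by decide)
  have hcf : NotInt (c - f) := h.2 2 5 (by decide)
  have hcg : NotInt (c - g) := h.2 2 6 (by decide)
  have hdf : NotInt (d - f) := h.2 3 5 (by decide)
  have hdg : NotInt (d - g) := h.2 3 6 (by decide)
  have hfa : NotInt (f - a) := h.2 5 0 (by decide)
  have hga : NotInt (g - a) := h.2 6 0 (by decide)
  have hca : NotInt (c - a) := h.2 2 0 (by decide)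
  have hda : NotInt (d - a) := h.2 3 0 (by decide)
  have t1 := tendsto_Fstar_sub_dougall (α := 1 - a) (β := 1 - b) (γ := 2 - e) (p := 1 - c)
    (q := 1 - d) (r := 2 - f) (t := 2 - g) (δ := e - a - b) (by linear_combination -hs) (by ring) hδ
    (hc.of_eq_sub 1 (by push_cast; ring)) (hd.of_eq_sub 1 (by push_cast; ring))
    (hf.of_eq_sub 2 (by push_cast; ring)) (hg.of_eq_sub 2 (by push_cast; ring))
    (hcd.of_eq_add 0 (by push_cast; ring)) (hcf.of_eq_add 1 (by push_cast; ring))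
    (hdf.of_eq_add 1 (by push_cast; ring)) (hcg.of_eq_add 1 (by push_cast; ring))
    (hdg.of_eq_add 1 (by push_cast; ring))
    (by rw [show 2 - f - (1 - c) = 1 + (c - f) by ring, add_re, one_re]; linarith)
    (by rw [show 2 - g - (1 - d) = 1 + (d - g) by ring, add_re, one_re]; linarith)
  have t2 := tendsto_Fstar_add_dougall (α := 1 - a) (β := e - a) (γ := 1 + b - a) (p := f - a)
    (q := g - a) (r := 1 + c - a) (t := 1 + d - a) (δ := e - a - b) (by linear_combination -hs)
    (by ring) hδ hfa hga
    (hca.of_eq_add 1 (by push_cast; ring)) (hda.of_eq_add 1 (by push_cast; ring))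
  have t := t1.add t2
  rw [add_zero] at t
  refine t.congr fun n => ?_
  rw [← add_div, Knum]
  congr 3 <;> ring

theorem tendsto_Knum_reflect_sub (hs : e + f + g = a + b + c + d + 1)
    (h : Generic ![a, b, c, d, e, f, g]) (hfc : 0 < (c - f).re) (hgd : 0 < (d - g).re) :
    Tendsto (fun n : ℕ => Knum (1 - a) (1 - b) (1 - (c - n)) (1 - (d - n)) (2 - e) (2 - (f - n))
      (2 - (g - n)) / ((n : ℂ) + 1) ^ (e - a - b - 1)) atTop
        (𝓝 (dougallVal (f - a) (g - a) (1 + c - a) (1 + d - a))) := by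
  have hδ : 1 < (e - a - b).re := by
    rw [show e - a - b = 1 + (c - f) + (d - g) by linear_combination hs]
    simp only [add_re, one_re]
    linarith
  have hc : NotInt c := h.1 2
  have hd : NotInt d := h.1 3
  have hf : NotInt f := h.1 5
  have hg : NotInt g := h.1 6
  have hgf : NotInt (g - f) := h.2 6 5 (by decide)
  have hcf : NotInt (c - f) := h.2 2 5 (by decide)
  have hcg : NotInt (c - g) := h.2 2 6 (by decide)
  have hdf : NotInt (d - f) := h.2 3 5 (by decide)
  have hdg : NotInt (d - g) := h.2 3 6 (by decide)
  have hfa : NotInt (f - a) := h.2 5 0 (by decide)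
  have hga : NotInt (g - a) := h.2 6 0 (by decide)
  have hca : NotInt (c - a) := h.2 2 0 (by decide)
  have hda : NotInt (d - a) := h.2 3 0 (by decide)
  have t1 := tendsto_Fstar_add_dougall (α := 1 - a) (β := 1 - b) (γ := 2 - e) (p := 1 - c)
    (q := 1 - d) (r := 2 - f) (t := 2 - g) (δ := e - a - b) (by linear_combination -hs) (by ring) hδ
    (hc.of_eq_sub 1 (by push_cast; ring)) (hd.of_eq_sub 1 (by push_cast; ring))
    (hf.of_eq_sub 2 (by push_cast; ring)) (hg.of_eq_sub 2 (by push_cast; ring))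
  have t2 := tendsto_Fstar_sub_dougall (α := 1 - a) (β := e - a) (γ := 1 + b - a) (p := f - a)
    (q := g - a) (r := 1 + c - a) (t := 1 + d - a) (δ := e - a - b) (by linear_combination -hs)
    (by ring) hδ hfa hga
    (hca.of_eq_add 1 (by push_cast; ring)) (hda.of_eq_add 1 (by push_cast; ring))
    (hgf.of_eq_add 0 (by push_cast; ring)) (hcf.of_eq_add 1 (by push_cast; ring))
    (hcg.of_eq_add 1 (by push_cast; ring)) (hdf.of_eq_add 1 (by push_cast; ring))
    (hdg.of_eq_add 1 (by push_cast; ring))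
    (by rw [show 1 + c - a - (f - a) = 1 + (c - f) by ring, add_re, one_re]; linarith)
    (by rw [show 1 + d - a - (g - a) = 1 + (d - g) by ring, add_re, one_re]; linarith)
  have t := t1.add t2
  rw [zero_add] at t
  refine t.congr fun n => ?_
  rw [← add_div, Knum]
  congr 3 <;> ring

end

section

variable {A B C D E F G : ℂ}

theorem trig_add_aux (hA : A ≠ 0) (hB : B ≠ 0) (hC : C ≠ 0) (hE : E ≠ 0) (hF : F ≠ 0)
    (hG : G ≠ 0) (v : ℂ → ℂ) (hv : ∀ x, v x = x - x⁻¹) (hD : D = -(E * F * G / (A * B * C))) :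
    (v (C / A) * v (D / A) * v (E / B) + v A * v (F / A) * v (G / A)) *
        (v B * v C * v D + v (E / A) * v F * v G) -
      v C * v D * (v (B / A) * v (C / A) * v (D / A) +
        v (E / A ^ 2) * v (F / A) * v (G / A)) * v (E / A / B) =
      v A * v (E / A) * (v (F / C) * v (F / D) * v (G / C) * v (G / D)) := by
  subst hD
  simp only [hv]
  field_simp
  ring

theorem trig_sub_aux (hA : A ≠ 0) (hB : B ≠ 0) (hC : C ≠ 0) (hE : E ≠ 0) (hF : F ≠ 0)
    (hG : G ≠ 0) (v : ℂ → ℂ) (hv : ∀ x, v x = x - x⁻¹) (hD : D = -(E * F * G / (A * B * C))) :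
    v (F / A) * v (G / A) * v E * (v B * v C * v D + v (E / A) * v F * v G) *
        (v (E / B) * v (E / C) * v (E / D) + v A * v (E / F) * v (E / G)) -
      (v (B / A) * v (C / A) * v (D / A) + v (E / A ^ 2) * v (F / A) * v (G / A)) *
        (v F * v G * v (E / A) * v (E / B) * v (E / C) * v (E / D) -
          v A * v B * v C * v D * v (E / F) * v (E / G)) =
      v A * v (E / A) * v E * v (F / B) * v (G / B) *
        (v (F / C) * v (F / D) * v (G / C) * v (G / D)) := by
  subst hD
  simp only [hv]
  field_simp
  ring

theorem trig_det_aux (hA : A ≠ 0) (hB : B ≠ 0) (hC : C ≠ 0) (hE : E ≠ 0) (hF : F ≠ 0)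
    (hG : G ≠ 0) (v : ℂ → ℂ) (hv : ∀ x, v x = x - x⁻¹) (hD : D = -(E * F * G / (A * B * C))) :
    (v F * v G * v (E / A) + v B * v C * v D) * (v E * v (E / A / B)) * v (F / A) * v (G / A) *
        v (E / C) * v (E / D) -
      (v (F / A) * v (G / A) * v (E / A) + v B * v (C / A) * v (D / A)) *
        (v F * v G * v (E / C) * v (E / D) * v (E / A) * v (E / B) -
          v A * v B * v (E / F) * v (E / G) * v C * v D) =
      -(v (F / C) * v (F / D) * v (G / C) * v (G / D) * v A * v B * v (E / A) * v E *
        v (E / C / D)) := by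
  subst hD
  simp only [hv]
  field_simp
  ring

end

theorem exists_exp (v : ℂ → ℂ) (hv : ∀ x, v x = x - x⁻¹) : ∃ p : ℂ → ℂ, (∀ x, p x ≠ 0) ∧
    (∀ x, Sn x = 1 / (2 * I) * v (p x)) ∧ (∀ x y, p (x - y) = p x / p y) ∧
    (∀ x, p (2 * x) = p x ^ 2) ∧
    ∀ a b c d e f g, e + f + g = a + b + c + d + 1 →
      p d = -(p e * p f * p g / (p a * p b * p c)) := by
  have hsub : ∀ x y : ℂ, exp (Real.pi * (x - y) * I) =
      exp (Real.pi * x * I) / exp (Real.pi * y * I) := fun x y => by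
    rw [← Complex.exp_sub]; ring_nf
  refine ⟨fun x => exp (Real.pi * x * I), fun x => exp_ne_zero _, fun x => ?_, hsub, fun x => ?_,
    fun a b c d e f g h => ?_⟩
  · rw [Sn, Complex.sin, hv, ← Complex.exp_neg, neg_mul]
    have := I_ne_zero
    field_simp
    rw [I_sq]
    ring
  · rw [← Complex.exp_nat_mul]
    push_cast
    ring_nf
  · simp only
    rw [← Complex.exp_add, ← Complex.exp_add, ← Complex.exp_add, ← Complex.exp_add,
      ← Complex.exp_sub, show (Real.pi * d * I : ℂ) = Real.pi * e * I + Real.pi * f * I +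
        Real.pi * g * I - (Real.pi * a * I + Real.pi * b * I + Real.pi * c * I) - Real.pi * I by
        linear_combination -(Real.pi * I : ℂ) * h, Complex.exp_sub _ (Real.pi * I),
      Complex.exp_pi_mul_I, div_neg, div_one]

section

variable {a b c d e f g : ℂ}

theorem trig_reflect (a b e : ℂ) :
    Sn (e - a) * Sn (e - b) - Sn a * Sn b = Sn e * Sn (e - a - b) := by
  obtain ⟨p, h0, h1, h2, -, -⟩ := exists_exp _ fun _ => rfl
  simp only [h1, h2]
  have := h0 a
  have := h0 b
  have := h0 e
  field_simp
  ring

theorem trig_add (hs : e + f + g = a + b + c + d + 1) :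
    (Sn (c - a) * Sn (d - a) * Sn (e - b) + Sn a * Sn (f - a) * Sn (g - a)) *
        (Sn b * Sn c * Sn d + Sn (e - a) * Sn f * Sn g) -
      Sn c * Sn d * (Sn (b - a) * Sn (c - a) * Sn (d - a) +
        Sn (e - 2 * a) * Sn (f - a) * Sn (g - a)) * Sn (e - a - b) =
      Sn a * Sn (e - a) * (Sn (f - c) * Sn (f - d) * Sn (g - c) * Sn (g - d)) := by
  obtain ⟨v, hv⟩ : ∃ v : ℂ → ℂ, ∀ x, v x = x - x⁻¹ := ⟨_, fun _ => rfl⟩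
  obtain ⟨p, h0, h1, h2, h3, h4⟩ := exists_exp v hv
  simp only [h1, h2, h3]
  linear_combination (1 / (2 * I)) ^ 6 * trig_add_aux (h0 a) (h0 b) (h0 c) (h0 e) (h0 f) (h0 g)
    v hv (h4 a b c d e f g hs)

theorem trig_sub (hs : e + f + g = a + b + c + d + 1) :
    Sn (f - a) * Sn (g - a) * Sn e * (Sn b * Sn c * Sn d + Sn (e - a) * Sn f * Sn g) *
        (Sn (e - b) * Sn (e - c) * Sn (e - d) + Sn a * Sn (e - f) * Sn (e - g)) -
      (Sn (b - a) * Sn (c - a) * Sn (d - a) + Sn (e - 2 * a) * Sn (f - a) * Sn (g - a)) *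
        (Sn f * Sn g * Sn (e - a) * Sn (e - b) * Sn (e - c) * Sn (e - d) -
          Sn a * Sn b * Sn c * Sn d * Sn (e - f) * Sn (e - g)) =
      Sn a * Sn (e - a) * Sn e * Sn (f - b) * Sn (g - b) *
        (Sn (f - c) * Sn (f - d) * Sn (g - c) * Sn (g - d)) := by
  obtain ⟨v, hv⟩ : ∃ v : ℂ → ℂ, ∀ x, v x = x - x⁻¹ := ⟨_, fun _ => rfl⟩
  obtain ⟨p, h0, h1, h2, h3, h4⟩ := exists_exp v hv
  simp only [h1, h2, h3]
  linear_combination (1 / (2 * I)) ^ 9 * trig_sub_aux (h0 a) (h0 b) (h0 c) (h0 e) (h0 f) (h0 g)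
    v hv (h4 a b c d e f g hs)

theorem trig_det (hs : e + f + g = a + b + c + d + 1) :
    (Sn f * Sn g * Sn (e - a) + Sn b * Sn c * Sn d) * (Sn e * Sn (e - a - b)) * Sn (f - a) *
        Sn (g - a) * Sn (e - c) * Sn (e - d) -
      (Sn (f - a) * Sn (g - a) * Sn (e - a) + Sn b * Sn (c - a) * Sn (d - a)) *
        (Sn f * Sn g * Sn (e - c) * Sn (e - d) * Sn (e - a) * Sn (e - b) -
          Sn a * Sn b * Sn (e - f) * Sn (e - g) * Sn c * Sn d) =
      -(Sn (f - c) * Sn (f - d) * Sn (g - c) * Sn (g - d) * Sn a * Sn b * Sn (e - a) * Sn e *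
        Sn (e - c - d)) := by
  obtain ⟨v, hv⟩ : ∃ v : ℂ → ℂ, ∀ x, v x = x - x⁻¹ := ⟨_, fun _ => rfl⟩
  obtain ⟨p, h0, h1, h2, h3, h4⟩ := exists_exp v hv
  simp only [h1, h2]
  linear_combination (1 / (2 * I)) ^ 9 * trig_det_aux (h0 a) (h0 b) (h0 c) (h0 e) (h0 f) (h0 g)
    v hv (h4 a b c d e f g hs)

end

section

variable {a b c d e f g : ℂ}

theorem reflConst_mul_dougallVal (hs : e + f + g = a + b + c + d + 1)
    (h : Generic ![a, b, c, d, e, f, g]) :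
    Real.pi ^ 3 * Sn a * Sn (e - a) * Gamma a * Gamma (1 + a - e) *
        (reflConst b c d e f g * dougallVal (1 - c) (1 - d) (2 - f) (2 - g)) =
      Sn a * Sn b * (Sn (f - c) * Sn (f - d) * Sn (g - c) * Sn (g - d)) / Sn (e - b) *
        gaussVal a b e := by
  have ha : NotInt a := h.1 0
  have hb : NotInt b := h.1 1
  have hc : NotInt c := h.1 2
  have hd : NotInt d := h.1 3
  have hea : NotInt (e - a) := h.2 4 0 (by decide)
  have heb : NotInt (e - b) := h.2 4 1 (by decide)
  have hfc : NotInt (f - c) := h.2 5 2 (by decide)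
  have hfd : NotInt (f - d) := h.2 5 3 (by decide)
  have hgc : NotInt (g - c) := h.2 6 2 (by decide)
  have hgd : NotInt (g - d) := h.2 6 3 (by decide)
  rw [dougallVal, gaussVal, reflConst, Sn_one_sub, Sn_one_sub,
    show 2 - f + (2 - g) - (1 - c) - (1 - d) - 1 = e - a - b by linear_combination -hs,
    show 2 - f - (1 - c) = 1 - (f - c) by ring, show 2 - f - (1 - d) = 1 - (f - d) by ring,
    show 2 - g - (1 - c) = 1 - (g - c) by ring, show 2 - g - (1 - d) = 1 - (g - d) by ring,
    show 1 + a - e = 1 - (e - a) by ring, show 1 + b - e = 1 - (e - b) by ring,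
    Gamma_one_sub_eq hb, Gamma_one_sub_eq hea, Gamma_one_sub_eq heb, Gamma_one_sub_eq hfc,
    Gamma_one_sub_eq hfd, Gamma_one_sub_eq hgc, Gamma_one_sub_eq hgd]
  have := ha.Gamma_ne_zero
  have := hb.Gamma_ne_zero
  have := hea.Gamma_ne_zero
  have := heb.Gamma_ne_zero
  have := hfc.Gamma_ne_zero
  have := hfd.Gamma_ne_zero
  have := hgc.Gamma_ne_zero
  have := hgd.Gamma_ne_zero
  have := ha.Sn_ne_zero
  have := hb.Sn_ne_zero
  have := hc.Sn_ne_zero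
  have := hd.Sn_ne_zero
  have := hea.Sn_ne_zero
  have := heb.Sn_ne_zero
  have := hfc.Sn_ne_zero
  have := hfd.Sn_ne_zero
  have := hgc.Sn_ne_zero
  have := hgd.Sn_ne_zero
  have := pi_ne_zero'
  clear ha hb hc hd hea heb hfc hfd hgc hgd h hs
  generalize Gamma a = x₁ at *
  generalize Gamma b = x₂ at *
  generalize Gamma (e - a) = x₃ at *
  generalize Gamma (e - b) = x₄ at *
  generalize Gamma (f - c) = x₅ at *
  generalize Gamma (f - d) = x₆ at *
  generalize Gamma (g - c) = x₇ at *
  generalize Gamma (g - d) = x₈ at *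
  generalize Gamma (e - a - b) = x₉ at *
  generalize Sn a = y₁ at *
  generalize Sn b = y₂ at *
  generalize Sn c = y₃ at *
  generalize Sn d = y₄ at *
  generalize Sn (e - a) = y₅ at *
  generalize Sn (e - b) = y₆ at *
  generalize Sn (f - c) = z₁ at *
  generalize Sn (f - d) = z₂ at *
  generalize Sn (g - c) = z₃ at *
  generalize Sn (g - d) = z₄ at *
  generalize (Real.pi : ℂ) = z at *
  field_simp

theorem dougallVal_sub (h : Generic ![a, b, c, d, e, f, g]) :
    dougallVal (f - a) (g - a) (1 + c - a) (1 + d - a) =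
      Sn c * Sn d / (Sn (f - a) * Sn (g - a)) * dougallVal (1 - c) (1 - d) (2 - f) (2 - g) := by
  have h1 := (h.1 2).Sn_ne_zero
  have h2 := (h.1 3).Sn_ne_zero
  change Sn c ≠ 0 at h1
  change Sn d ≠ 0 at h2
  rw [dougallVal, dougallVal, Sn_one_sub, Sn_one_sub,
    show 1 + c - a + (1 + d - a) - (f - a) - (g - a) - 1 =
      2 - f + (2 - g) - (1 - c) - (1 - d) - 1 by ring,
    show 1 + c - a - (f - a) = 2 - f - (1 - c) by ring,
    show 1 + d - a - (f - a) = 2 - f - (1 - d) by ring,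
    show 1 + c - a - (g - a) = 2 - g - (1 - c) by ring,
    show 1 + d - a - (g - a) = 2 - g - (1 - d) by ring, div_mul_div_comm, div_mul_div_comm,
    ← mul_assoc, div_mul_div_comm, mul_div_mul_comm]
  field_simp

theorem reflConst_mul_dougallVal_sub (h : Generic ![a, b, c, d, e, f, g]) :
    reflConst b c d e f g * (Sn (f - a) * Sn (f - b) / (Sn c * Sn (e - c)) *
        (Sn (g - a) * Sn (g - b) / (Sn d * Sn (e - d)))) *
        dougallVal (f - a) (g - a) (1 + c - a) (1 + d - a) =
      Sn (f - b) * Sn (g - b) / (Sn (e - c) * Sn (e - d)) *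
        (reflConst b c d e f g * dougallVal (1 - c) (1 - d) (2 - f) (2 - g)) := by
  have hc : NotInt c := h.1 2
  have hd : NotInt d := h.1 3
  have hfa : NotInt (f - a) := h.2 5 0 (by decide)
  have hga : NotInt (g - a) := h.2 6 0 (by decide)
  have := hc.Sn_ne_zero
  have := hd.Sn_ne_zero
  have := hfa.Sn_ne_zero
  have := hga.Sn_ne_zero
  rw [dougallVal_sub h]
  generalize reflConst b c d e f g = x
  generalize dougallVal (1 - c) (1 - d) (2 - f) (2 - g) = y
  field_simp

end

/-- The coefficient of `Knum` in the three-term relation. -/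
def coefK (a b c d e f g : ℂ) : ℂ :=
  Sn (f - a) * Sn (g - a) * (Sn b * Sn c * Sn d + Sn (e - a) * Sn f * Sn g)

/-- The coefficient of `Lnum` in the relation between `Knum - Lnum`, `Lnum` and `Rnum`. -/
def coefL (a b c d e f g : ℂ) : ℂ :=
  Sn b * Sn c * Sn d *
    (Sn (b - a) * Sn (c - a) * Sn (d - a) + Sn (e - 2 * a) * Sn (f - a) * Sn (g - a)) / Sn e

/-- The coefficient of `Rnum` in the three-term relation. -/
def coefR (a e : ℂ) : ℂ :=
  Real.pi ^ 3 * Sn a * Sn (e - a) * Gamma a * Gamma (1 + a - e)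

section

variable {a b c d e f g : ℂ}

theorem tendsto_Rnum_add (hs : e + f + g = a + b + c + d + 1)
    (h : Generic ![a, b, c, d, e, f, g]) (hcf : 0 < (c - f).re) (hdg : 0 < (d - g).re) :
    Tendsto (fun n : ℕ => coefR a e * Rnum a b (c + n) (d + n) e (f + n) (g + n) /
      ((n : ℂ) + 1) ^ (e - a - b - 1)) atTop
        (𝓝 (Sn a * Sn b * (Sn (f - c) * Sn (f - d) * Sn (g - c) * Sn (g - d)) / Sn (e - b) *
          gaussVal a b e)) := by
  have t := ((tendsto_reflFactor_add hs h).mul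
    (tendsto_Knum_reflect_add hs h hcf hdg)).const_mul (coefR a e)
  rw [coefR, reflConst_mul_dougallVal hs h] at t
  exact t.congr fun n => by rw [Rnum, coefR]; ring

theorem tendsto_Rnum_sub (hs : e + f + g = a + b + c + d + 1)
    (h : Generic ![a, b, c, d, e, f, g]) (hcf : 0 < (c - f).re) (hdg : 0 < (d - g).re) :
    Tendsto (fun n : ℕ => coefR a e * Rnum a b (c - n) (d - n) e (f - n) (g - n) /
      ((n : ℂ) + 1) ^ (e - a - b - 1)) atTop
        (𝓝 (Sn (f - b) * Sn (g - b) / (Sn (e - c) * Sn (e - d)) *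
          (Sn a * Sn b * (Sn (f - c) * Sn (f - d) * Sn (g - c) * Sn (g - d)) / Sn (e - b) *
          gaussVal a b e))) := by
  have t := ((tendsto_reflFactor_sub hs h).mul
    (tendsto_Knum_reflect_sub hs h hcf hdg)).const_mul (coefR a e)
  rw [reflConst_mul_dougallVal_sub h, mul_left_comm, coefR, reflConst_mul_dougallVal hs h] at t
  exact t.congr fun n => by rw [Rnum, coefR]; ring

theorem coef_limit_add (hs : e + f + g = a + b + c + d + 1)
    (h : Generic ![a, b, c, d, e, f, g]) :
    coefK a b c d e f g * (Sn (c - a) * Sn (d - a) / (Sn (f - a) * Sn (g - a)) *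
        (Sn b / Sn (e - a)) + Sn a * Sn b / (Sn (e - a) * Sn (e - b))) -
      coefL a b c d e f g * (1 - Sn a * Sn b / (Sn (e - a) * Sn (e - b))) =
    Sn a * Sn b * (Sn (f - c) * Sn (f - d) * Sn (g - c) * Sn (g - d)) / Sn (e - b) := by
  have he : NotInt e := h.1 4
  have hea : NotInt (e - a) := h.2 4 0 (by decide)
  have heb : NotInt (e - b) := h.2 4 1 (by decide)
  have hfa : NotInt (f - a) := h.2 5 0 (by decide)
  have hga : NotInt (g - a) := h.2 6 0 (by decide)
  have := he.Sn_ne_zero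
  have := hea.Sn_ne_zero
  have := heb.Sn_ne_zero
  have := hfa.Sn_ne_zero
  have := hga.Sn_ne_zero
  have t := trig_add hs
  have r := trig_reflect a b e
  rw [coefK, coefL]
  generalize Sn (b - a) * Sn (c - a) * Sn (d - a) + Sn (e - 2 * a) * Sn (f - a) * Sn (g - a) = p
    at *
  field_simp
  linear_combination Sn b * Sn e * t - Sn b * p * Sn c * Sn d * r

theorem coef_limit_sub (hs : e + f + g = a + b + c + d + 1)
    (h : Generic ![a, b, c, d, e, f, g]) :
    coefK a b c d e f g * (Sn b / Sn (e - a) + Sn (e - f) * Sn (e - g) /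
        (Sn (e - c) * Sn (e - d)) * (Sn a * Sn b / (Sn (e - a) * Sn (e - b)))) -
      coefL a b c d e f g * (Sn f * Sn g / (Sn c * Sn d) - Sn (e - f) * Sn (e - g) /
        (Sn (e - c) * Sn (e - d)) * (Sn a * Sn b / (Sn (e - a) * Sn (e - b)))) =
    Sn (f - b) * Sn (g - b) / (Sn (e - c) * Sn (e - d)) *
      (Sn a * Sn b * (Sn (f - c) * Sn (f - d) * Sn (g - c) * Sn (g - d)) / Sn (e - b)) := by
  have hc : NotInt c := h.1 2
  have hd : NotInt d := h.1 3
  have he : NotInt e := h.1 4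
  have hea : NotInt (e - a) := h.2 4 0 (by decide)
  have heb : NotInt (e - b) := h.2 4 1 (by decide)
  have hec : NotInt (e - c) := h.2 4 2 (by decide)
  have hed : NotInt (e - d) := h.2 4 3 (by decide)
  have := hc.Sn_ne_zero
  have := hd.Sn_ne_zero
  have := he.Sn_ne_zero
  have := hea.Sn_ne_zero
  have := heb.Sn_ne_zero
  have := hec.Sn_ne_zero
  have := hed.Sn_ne_zero
  have t := trig_sub hs
  rw [coefK, coefL]
  generalize Sn (b - a) * Sn (c - a) * Sn (d - a) + Sn (e - 2 * a) * Sn (f - a) * Sn (g - a) = p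
    at *
  field_simp
  linear_combination Sn b * t

theorem coef_limit_det (hs : e + f + g = a + b + c + d + 1)
    (h : Generic ![a, b, c, d, e, f, g]) (hecd : NotInt (e - c - d)) :
    (Sn (c - a) * Sn (d - a) / (Sn (f - a) * Sn (g - a)) *
        (Sn b / Sn (e - a)) + Sn a * Sn b / (Sn (e - a) * Sn (e - b))) *
      (Sn f * Sn g / (Sn c * Sn d) - Sn (e - f) * Sn (e - g) /
        (Sn (e - c) * Sn (e - d)) * (Sn a * Sn b / (Sn (e - a) * Sn (e - b)))) -
    (1 - Sn a * Sn b / (Sn (e - a) * Sn (e - b))) *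
      (Sn b / Sn (e - a) + Sn (e - f) * Sn (e - g) /
        (Sn (e - c) * Sn (e - d)) * (Sn a * Sn b / (Sn (e - a) * Sn (e - b)))) ≠ 0 := by
  have ha : NotInt a := h.1 0
  have hb : NotInt b := h.1 1
  have hc : NotInt c := h.1 2
  have hd : NotInt d := h.1 3
  have he : NotInt e := h.1 4
  have hea : NotInt (e - a) := h.2 4 0 (by decide)
  have heb : NotInt (e - b) := h.2 4 1 (by decide)
  have hec : NotInt (e - c) := h.2 4 2 (by decide)
  have hed : NotInt (e - d) := h.2 4 3 (by decide)
  have hfa : NotInt (f - a) := h.2 5 0 (by decide)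
  have hga : NotInt (g - a) := h.2 6 0 (by decide)
  have hfc : NotInt (f - c) := h.2 5 2 (by decide)
  have hfd : NotInt (f - d) := h.2 5 3 (by decide)
  have hgc : NotInt (g - c) := h.2 6 2 (by decide)
  have hgd : NotInt (g - d) := h.2 6 3 (by decide)
  have := ha.Sn_ne_zero
  have := hb.Sn_ne_zero
  have := hc.Sn_ne_zero
  have := hd.Sn_ne_zero
  have := he.Sn_ne_zero
  have := hea.Sn_ne_zero
  have := heb.Sn_ne_zero
  have := hec.Sn_ne_zero
  have := hed.Sn_ne_zero
  have := hfa.Sn_ne_zero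
  have := hga.Sn_ne_zero
  have := hfc.Sn_ne_zero
  have := hfd.Sn_ne_zero
  have := hgc.Sn_ne_zero
  have := hgd.Sn_ne_zero
  have := hecd.Sn_ne_zero
  have t := trig_det hs
  rw [← trig_reflect a b e] at t
  have key : (Sn (c - a) * Sn (d - a) / (Sn (f - a) * Sn (g - a)) *
        (Sn b / Sn (e - a)) + Sn a * Sn b / (Sn (e - a) * Sn (e - b))) *
      (Sn f * Sn g / (Sn c * Sn d) - Sn (e - f) * Sn (e - g) /
        (Sn (e - c) * Sn (e - d)) * (Sn a * Sn b / (Sn (e - a) * Sn (e - b)))) -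
    (1 - Sn a * Sn b / (Sn (e - a) * Sn (e - b))) *
      (Sn b / Sn (e - a) + Sn (e - f) * Sn (e - g) /
        (Sn (e - c) * Sn (e - d)) * (Sn a * Sn b / (Sn (e - a) * Sn (e - b)))) =
    Sn (f - c) * Sn (f - d) * Sn (g - c) * Sn (g - d) * Sn a * Sn b * Sn (e - a) * Sn e *
        Sn (e - c - d) / (Sn (e - a) ^ 2 * Sn (e - b) * Sn (f - a) * Sn (g - a) * Sn (e - c) *
          Sn (e - d) * Sn c * Sn d) := by
    field_simp
    apply mul_left_cancel₀ hb.Sn_ne_zero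
    linear_combination -Sn (e - b) * t
  rw [key]
  positivity

end

section

variable {a b c d e f g : ℂ}

theorem gaussVal_ne_zero {α β γ : ℂ} (hα : NotInt α) (hβ : NotInt β) (hγα : NotInt (γ - α))
    (hγβ : NotInt (γ - β)) (h : 0 < (γ - α - β).re) : gaussVal α β γ ≠ 0 :=
  div_ne_zero (mul_ne_zero (mul_ne_zero hα.Gamma_ne_zero hβ.Gamma_ne_zero)
    (Complex.Gamma_ne_zero_of_re_pos h)) (mul_ne_zero hγα.Gamma_ne_zero hγβ.Gamma_ne_zero)

/-- The combination of `Knum`, `Lnum` and `Rnum` that is to vanish. -/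
def relDefect (a b c d e f g : ℂ) : ℂ :=
  coefK a b c d e f g * (Knum a b c d e f g - Lnum a b c d e f g) -
    coefL a b c d e f g * Lnum a b c d e f g - coefR a e * Rnum a b c d e f g

theorem relDefect_eq_zero_of_re (hs : e + f + g = a + b + c + d + 1)
    (h : Generic ![a, b, c, d, e, f, g]) (hecd : NotInt (e - c - d))
    (hcf : 0 < (c - f).re) (hdg : 0 < (d - g).re) : relDefect a b c d e f g = 0 := by
  have hδ : 1 < (e - a - b).re := by
    rw [show e - a - b = 1 + (c - f) + (d - g) by linear_combination hs]
    simp only [add_re, one_re]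
    linarith
  have hc : NotInt c := h.1 2
  have hd : NotInt d := h.1 3
  have hec : NotInt (e - c) := h.2 4 2 (by decide)
  have hed : NotInt (e - d) := h.2 4 3 (by decide)
  have haf : NotInt (a - f) := h.2 0 5 (by decide)
  have hag : NotInt (a - g) := h.2 0 6 (by decide)
  have hbf : NotInt (b - f) := h.2 1 5 (by decide)
  have hbg : NotInt (b - g) := h.2 1 6 (by decide)
  have hG : gaussVal a b e ≠ 0 := gaussVal_ne_zero (h.1 0) (h.1 1) (h.2 4 0 (by decide))
    (h.2 4 1 (by decide)) (by linarith)
  let N : ℂ → ℂ → ℂ → ℂ → ℂ → ℂ → ℂ → ℂ :=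
    fun a b c d e f g => Knum a b c d e f g - Lnum a b c d e f g
  have hNswap : ∀ a b c d e f g, N a b d c e g f = N a b c d e f g := fun a b c d e f g => by
    simp only [N, Knum_swap, Lnum_swap]
  have hNrec : ∀ {a b c d e f g : ℂ}, e + f + g = a + b + c + d + 1 →
      Generic ![a, b, c, d, e, f, g] → ContigRel N a b c d e f g := fun hs h => by
    have h1 := Knum_rec hs h
    have h2 := Lnum_rec hs h
    simp only [ContigRel, N] at h1 h2 ⊢
    linear_combination h1 - h2
  let W : ℂ → ℂ → ℂ → ℂ → ℂ → ℂ → ℂ → ℂ := fun a' b' c' d' e' f' g' =>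
    coefK a b c d e f g * N a' b' c' d' e' f' g' -
      coefL a b c d e f g * Lnum a' b' c' d' e' f' g' - coefR a e * Rnum a' b' c' d' e' f' g'
  have hWswap : ∀ a b c d e f g, W a b d c e g f = W a b c d e f g := fun a b c d e f g => by
    simp only [W, hNswap, Lnum_swap, Rnum_swap]
  have hWrec : ∀ {a b c d e f g : ℂ}, e + f + g = a + b + c + d + 1 →
      Generic ![a, b, c, d, e, f, g] → ContigRel W a b c d e f g := fun {a' b' c' d' e' f' g'} hs h => by
    have h1 := hNrec hs h
    have h2 := Lnum_rec hs h
    have h3 := Rnum_rec hs h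
    simp only [ContigRel, W] at h1 h2 h3 ⊢
    linear_combination coefK a b c d e f g * h1 - coefL a b c d e f g * h2 - coefR a e * h3
  have hN1 := tendsto_Knum_sub_Lnum_add hs h hδ
  have hN2 := tendsto_Knum_sub_Lnum_sub hs h hδ
  have hL1 := tendsto_Lnum_add hs h hδ
  have hL2 := tendsto_Lnum_sub hs h hδ
  have hR1 := tendsto_Rnum_add hs h hcf hdg
  have hR2 := tendsto_Rnum_sub hs h hcf hdg
  have z1 := coef_limit_add hs h
  have z2 := coef_limit_sub hs h
  have z3 := coef_limit_det hs h hecd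
  generalize Sn (c - a) * Sn (d - a) / (Sn (f - a) * Sn (g - a)) * (Sn b / Sn (e - a)) +
    Sn a * Sn b / (Sn (e - a) * Sn (e - b)) = x₀ at hN1 z1 z3
  generalize Sn b / Sn (e - a) + Sn (e - f) * Sn (e - g) / (Sn (e - c) * Sn (e - d)) *
    (Sn a * Sn b / (Sn (e - a) * Sn (e - b))) = y₀ at hN2 z2 z3
  generalize Sn f * Sn g / (Sn c * Sn d) - Sn (e - f) * Sn (e - g) / (Sn (e - c) * Sn (e - d)) *
    (Sn a * Sn b / (Sn (e - a) * Sn (e - b))) = y₁ at hL2 z2 z3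
  generalize 1 - Sn a * Sn b / (Sn (e - a) * Sn (e - b)) = x₁ at hL1 z1 z3
  have key := Interlaced.eq_zero_of_tendsto
    (U := ![fun j => N a b (c + j) (d + j) e (f + j) (g + j),
      fun j => Lnum a b (c + j) (d + j) e (f + j) (g + j),
      fun j => W a b (c + j) (d + j) e (f + j) (g + j)])
    (V := ![fun j => N a b (c + j + 1) (d + j) e (f + j + 1) (g + j),
      fun j => Lnum a b (c + j + 1) (d + j) e (f + j + 1) (g + j),
      fun j => W a b (c + j + 1) (d + j) e (f + j + 1) (g + j)])
    (ω := fun n => ((n : ℂ) + 1) ^ (e - a - b - 1))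
    (α := fun j => (c + j) * (e - 1 - (c + j)))
    (β := fun j => (f + j - (d + j)) * (c + j + (d + j) + 1 - e))
    (γ := fun j => (a - (g + j)) * (b - (g + j)))
    (α' := fun j => (d + j) * (e - 1 - (d + j)))
    (β' := fun j => (g + j - (c + j + 1)) * (d + j + (c + j + 1) + 1 - e))
    (γ' := fun j => (a - (f + j + 1)) * (b - (f + j + 1)))
    (x := ![x₀ * gaussVal a b e, x₁ * gaussVal a b e])
    (y := ![y₀ * gaussVal a b e, y₁ * gaussVal a b e]) ?_ ?_ ?_ ?_ ?_ hN1 ?_ hL1 ?_ ?_ ?_ ?_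
  · simpa [W, N, relDefect] using key
  · intro i
    fin_cases i
    · exact interlaced_of_contigRel hNswap hNrec hs h
    · exact interlaced_of_contigRel Lnum_swap Lnum_rec hs h
    · exact interlaced_of_contigRel hWswap hWrec hs h
  · exact fun j => mul_ne_zero (hc.of_eq_add j rfl).ne_zero
      (hec.of_eq_add (-1 - j) (by push_cast; ring)).ne_zero
  · exact fun j => mul_ne_zero (hag.of_eq_add (-j) (by push_cast; ring)).ne_zero
      (hbg.of_eq_add (-j) (by push_cast; ring)).ne_zero
  · exact fun j => mul_ne_zero (hd.of_eq_add j rfl).ne_zero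
      (hed.of_eq_add (-1 - j) (by push_cast; ring)).ne_zero
  · exact fun j => mul_ne_zero (haf.of_eq_add (-j - 1) (by push_cast; ring)).ne_zero
      (hbf.of_eq_add (-j - 1) (by push_cast; ring)).ne_zero
  · simpa [sub_eq_add_neg, N] using hN2
  · simpa [sub_eq_add_neg] using hL2
  · have t := ((hN1.const_mul (coefK a b c d e f g)).sub
      (hL1.const_mul (coefL a b c d e f g))).sub hR1
    convert t using 2 with n
    · simp [W, N]
      ring
    · linear_combination -gaussVal a b e * z1
  · have t := ((hN2.const_mul (coefK a b c d e f g)).sub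
      (hL2.const_mul (coefL a b c d e f g))).sub hR2
    convert t using 2 with n
    · simp [W, N, ← sub_eq_add_neg]
      ring
    · linear_combination -gaussVal a b e * z2
  · have t := mul_ne_zero (mul_ne_zero hG hG) z3
    refine fun z => t ?_
    simp at z
    linear_combination z

end

theorem relDefect_swap (a b c d e f g : ℂ) :
    relDefect a b d c e g f = relDefect a b c d e f g := by
  rw [relDefect, relDefect, Knum_swap, Lnum_swap, Rnum_swap, coefK, coefK, coefL, coefL]
  ring

theorem relDefect_rotate (a b c d e f g : ℂ) :
    relDefect a c d b e g f = relDefect a b c d e f g := by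
  rw [relDefect, relDefect, Knum_rotate, Lnum_rotate, Rnum_rotate, coefK, coefK, coefL, coefL]
  ring

theorem coefK_shift (a b c d e f g : ℂ) :
    coefK a b (c + 1) d e (f + 1) g = coefK a b c d e f g := by
  rw [coefK, coefK, add_sub_right_comm, Sn_add_one, Sn_add_one, Sn_add_one]
  ring

theorem coefL_shift (a b c d e f g : ℂ) :
    coefL a b (c + 1) d e (f + 1) g = coefL a b c d e f g := by
  rw [coefL, coefL, add_sub_right_comm, add_sub_right_comm, Sn_add_one, Sn_add_one, Sn_add_one]
  ring

section

variable {a b c d e f g : ℂ}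

theorem relDefect_rec (hs : e + f + g = a + b + c + d + 1) (h : Generic ![a, b, c, d, e, f, g]) :
    ContigRel relDefect a b c d e f g := by
  have h1 := Knum_rec hs h
  have h2 := Lnum_rec hs h
  have h3 := Rnum_rec hs h
  have hK : coefK a b (c + 1) (d + 1) e (f + 1) (g + 1) = coefK a b c d e f g := by
    rw [coefK_shift, coefK, coefK, add_sub_right_comm, Sn_add_one, Sn_add_one, Sn_add_one]
    ring
  have hL : coefL a b (c + 1) (d + 1) e (f + 1) (g + 1) = coefL a b c d e f g := by
    rw [coefL_shift, coefL, coefL, add_sub_right_comm, add_sub_right_comm, Sn_add_one, Sn_add_one,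
      Sn_add_one]
    ring
  simp only [ContigRel, relDefect, coefK_shift, coefL_shift, hK, hL] at h1 h2 h3 ⊢
  linear_combination coefK a b c d e f g * h1 -
    (coefK a b c d e f g + coefL a b c d e f g) * h2 - coefR a e * h3

theorem relDefect_eq_zero_of_sub_one (hs : e + f + g = a + b + c + d + 1)
    (h : Generic ![a, b, c, d, e, f, g]) (h1 : relDefect a (b - 1) c d e (f - 1) g = 0)
    (h2 : relDefect a (b - 1) c (d - 1) e (f - 1) (g - 1) = 0) :
    relDefect a b c d e f g = 0 := by
  have haf : NotInt (a - f) := h.2 0 5 (by decide)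
  have hcf : NotInt (c - f) := h.2 2 5 (by decide)
  have hg : Generic ![a, c, d - 1, b - 1, e, g - 1, f - 1] := by
    simpa [sub_eq_add_neg] using h.rotate.shift (-1) (-1)
  have t := relDefect_rec (by linear_combination hs) hg
  rw [ContigRel] at t
  simp only [sub_add_cancel] at t
  rw [relDefect_rotate a b, relDefect_rotate a (b - 1) c d, relDefect_rotate a (b - 1), h1, h2]
    at t
  have n1 : a - (f - 1) ≠ 0 := (haf.of_eq_add 1 (by push_cast; ring)).ne_zero
  have n2 : c - (f - 1) ≠ 0 := (hcf.of_eq_add 1 (by push_cast; ring)).ne_zero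
  simpa [n1, n2] using t

theorem relDefect_eq_zero_of_re_right (n : ℕ) (hs : e + f + g = a + b + c + d + 1)
    (h : Generic ![a, b, c, d, e, f, g]) (hecd : NotInt (e - c - d))
    (hcf : 0 < (c - f).re + n) (hdg : 0 < (d - g).re) : relDefect a b c d e f g = 0 := by
  induction n generalizing b d f g with
  | zero => exact relDefect_eq_zero_of_re hs h hecd (by simpa using hcf) hdg
  | succ n ih =>
    have hre : 0 < (c - (f - 1)).re + n := by
      simp only [sub_re, one_re] at hcf ⊢
      push_cast at hcf
      linarith
    refine relDefect_eq_zero_of_sub_one hs h ?_ ?_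
    · exact ih (by linear_combination hs)
        (h.add ![0, -1, 0, 0, 0, -1, 0] (by intro i; fin_cases i <;> simp [sub_eq_add_neg]))
        hecd hre hdg
    · exact ih (by linear_combination hs)
        (h.add ![0, -1, 0, -1, 0, -1, -1] (by intro i; fin_cases i <;> simp [sub_eq_add_neg]))
        (hecd.of_eq_add 1 (by push_cast; ring)) hre (by simpa using hdg)

theorem relDefect_eq_zero_of_nat (n : ℕ) (hs : e + f + g = a + b + c + d + 1)
    (h : Generic ![a, b, c, d, e, f, g]) (hecd : NotInt (e - c - d))
    (hdg : 0 < (d - g).re + n) : relDefect a b c d e f g = 0 := by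
  induction n generalizing b c f g with
  | zero =>
    obtain ⟨m, hm⟩ := exists_nat_gt (-(c - f).re)
    exact relDefect_eq_zero_of_re_right m hs h hecd (by linarith) (by simpa using hdg)
  | succ n ih =>
    have hre : 0 < (d - (g - 1)).re + n := by
      simp only [sub_re, one_re] at hdg ⊢
      push_cast at hdg
      linarith
    rw [← relDefect_swap]
    refine relDefect_eq_zero_of_sub_one (by linear_combination hs) h.swap ?_ ?_
    · rw [relDefect_swap]
      exact ih (by linear_combination hs)
        (h.add ![0, -1, 0, 0, 0, 0, -1] (by intro i; fin_cases i <;> simp [sub_eq_add_neg]))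
        hecd hre
    · rw [relDefect_swap]
      exact ih (by linear_combination hs)
        (h.add ![0, -1, -1, 0, 0, -1, -1] (by intro i; fin_cases i <;> simp [sub_eq_add_neg]))
        (hecd.of_eq_add 1 (by push_cast; ring)) hre

theorem relDefect_eq_zero (hs : e + f + g = a + b + c + d + 1)
    (h : Generic ![a, b, c, d, e, f, g]) : relDefect a b c d e f g = 0 := by
  have key : ∀ {a b c d e f g : ℂ}, e + f + g = a + b + c + d + 1 →
      Generic ![a, b, c, d, e, f, g] → NotInt (e - c - d) → relDefect a b c d e f g = 0 := by
    intro a b c d e f g hs h hecd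
    obtain ⟨m, hm⟩ := exists_nat_gt (-(d - g).re)
    exact relDefect_eq_zero_of_nat m hs h hecd (by linarith)
  by_cases hecd : NotInt (e - c - d)
  · exact key hs h hecd
  · rw [← relDefect_rotate]
    have hcb : NotInt (c - b) := h.2 2 1 (by decide)
    simp only [NotInt, not_forall, not_not] at hecd
    obtain ⟨n, hn⟩ := hecd
    exact key (by linear_combination hs) h.rotate
      (hcb.of_eq_add n (by linear_combination hn))

end

theorem orbit7_LKK_relation (a b c d e f g : ℂ)
    (hsaal : e + f + g = a + b + c + d + 1)
    (hint : ∀ i : Fin 7, ∀ n : ℤ, ![a, b, c, d, e, f, g] i ≠ (n : ℂ))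
    (hdiff : ∀ i j : Fin 7, i ≠ j → ∀ n : ℤ,
      ![a, b, c, d, e, f, g] i - ![a, b, c, d, e, f, g] j ≠ (n : ℂ)) :
    Af (1 + a - e) (1 + b - e) (1 + c - e) (1 + d - e) * Af (1 - a) (e - a) (f - a) (g - a) *
        B4 a b c d e f g * Kf a b c d e f g -
      Sn (e - a) * Af (f - a) (f - b) (f - c) (f - d) * Af (g - a) (g - b) (g - c) (g - d) *
        Af a b c d * Af a (1 + a - e) (1 + a - f) (1 + a - g) *
        Kf (1 - a) (1 - b) (1 - c) (1 - d) (2 - e) (2 - f) (2 - g) -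
      Cf a b c d e f g * Lf a b c d e f g = 0 := by
  have h : Generic ![a, b, c, d, e, f, g] :=
    ⟨fun i n => hint i n, fun i j hij n => hdiff i j hij n⟩
  have ha : NotInt a := h.1 0
  have hb : NotInt b := h.1 1
  have hc : NotInt c := h.1 2
  have hd : NotInt d := h.1 3
  have he : NotInt e := h.1 4
  have hea : NotInt (e - a) := h.2 4 0 (by decide)
  have hbe : NotInt (b - e) := h.2 1 4 (by decide)
  have hce : NotInt (c - e) := h.2 2 4 (by decide)
  have hde : NotInt (d - e) := h.2 3 4 (by decide)
  have hfa : NotInt (f - a) := h.2 5 0 (by decide)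
  have hga : NotInt (g - a) := h.2 6 0 (by decide)
  have hW := relDefect_eq_zero hsaal h
  rw [relDefect, coefK, coefL, coefR, Rnum, reflFactor] at hW
  rw [Kf, Kf, Lf, ← Knum, ← Lnum, ← Knum]
  simp only [Cf, B2, B4, Af]
  rw [Sn_one_sub, show 1 + (1 - a) - (2 - e) = e - a by ring,
    show 1 + (1 - a) - (2 - f) = f - a by ring, show 1 + (1 - a) - (2 - g) = g - a by ring]
  rw [show 1 + a - e = 1 - (e - a) by ring, Gamma_one_sub_eq hea] at hW ⊢
  rw [show 1 + a - f = 1 - (f - a) by ring, Gamma_one_sub_eq hfa,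
    show 1 + a - g = 1 - (g - a) by ring, Gamma_one_sub_eq hga, Gamma_one_sub_eq ha]
  have := pi_ne_zero'
  have := ha.Sn_ne_zero
  have := he.Sn_ne_zero
  have := hea.Sn_ne_zero
  have := hfa.Sn_ne_zero
  have := hga.Sn_ne_zero
  have := ha.Gamma_ne_zero
  have := hb.Gamma_ne_zero
  have := hc.Gamma_ne_zero
  have := hd.Gamma_ne_zero
  have := hea.Gamma_ne_zero
  have := hfa.Gamma_ne_zero
  have := hga.Gamma_ne_zero
  have : Gamma (1 + b - e) ≠ 0 := (hbe.of_eq_add 1 (by push_cast; ring)).Gamma_ne_zero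
  have : Gamma (1 + c - e) ≠ 0 := (hce.of_eq_add 1 (by push_cast; ring)).Gamma_ne_zero
  have : Gamma (1 + d - e) ≠ 0 := (hde.of_eq_add 1 (by push_cast; ring)).Gamma_ne_zero
  have : Gamma (1 - b) ≠ 0 := (hb.of_eq_sub 1 (by push_cast; ring)).Gamma_ne_zero
  have : Gamma (1 - c) ≠ 0 := (hc.of_eq_sub 1 (by push_cast; ring)).Gamma_ne_zero
  have : Gamma (1 - d) ≠ 0 := (hd.of_eq_sub 1 (by push_cast; ring)).Gamma_ne_zero
  have : Gamma (f - b) ≠ 0 := NotInt.Gamma_ne_zero (h.2 5 1 (by decide))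
  have : Gamma (f - c) ≠ 0 := NotInt.Gamma_ne_zero (h.2 5 2 (by decide))
  have : Gamma (f - d) ≠ 0 := NotInt.Gamma_ne_zero (h.2 5 3 (by decide))
  have : Gamma (g - b) ≠ 0 := NotInt.Gamma_ne_zero (h.2 6 1 (by decide))
  have : Gamma (g - c) ≠ 0 := NotInt.Gamma_ne_zero (h.2 6 2 (by decide))
  have : Gamma (g - d) ≠ 0 := NotInt.Gamma_ne_zero (h.2 6 3 (by decide))
  clear ha hb hc hd he hea hbe hce hde hfa hga h hint hdiff hsaal
  generalize Knum a b c d e f g = k at *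
  generalize Lnum a b c d e f g = l at *
  generalize Knum (1 - a) (1 - b) (1 - c) (1 - d) (2 - e) (2 - f) (2 - g) = k' at *
  generalize Sn (b - a) * Sn (c - a) * Sn (d - a) + Sn (e - 2 * a) * Sn (f - a) * Sn (g - a) = p
    at *
  generalize Sn b * Sn c * Sn d + Sn (e - a) * Sn f * Sn g = q at *
  generalize Sn a = s₁ at *
  generalize Sn b = s₂ at *
  generalize Sn c = s₃ at *
  generalize Sn d = s₄ at *
  generalize Sn e = s₅ at *
  generalize Sn (e - a) = s₆ at *
  generalize Sn (f - a) = s₇ at *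
  generalize Sn (g - a) = s₈ at *
  generalize Gamma a = x₁ at *
  generalize Gamma b = x₂ at *
  generalize Gamma c = x₃ at *
  generalize Gamma d = x₄ at *
  generalize Gamma (e - a) = x₅ at *
  generalize Gamma (f - a) = x₆ at *
  generalize Gamma (g - a) = x₇ at *
  generalize Gamma (1 + b - e) = y₁ at *
  generalize Gamma (1 + c - e) = y₂ at *
  generalize Gamma (1 + d - e) = y₃ at *
  generalize Gamma (1 - b) = w₁ at *
  generalize Gamma (1 - c) = w₂ at *
  generalize Gamma (1 - d) = w₃ at *
  generalize Gamma (f - b) = u₁ at *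
  generalize Gamma (f - c) = u₂ at *
  generalize Gamma (f - d) = u₃ at *
  generalize Gamma (g - b) = v₁ at *
  generalize Gamma (g - c) = v₂ at *
  generalize Gamma (g - d) = v₃ at *
  generalize (Real.pi : ℂ) = z at *
  rw [← mul_zero (s₆ ^ 2 * s₇ * s₈ * x₅ / (z ^ 9 * x₁ * x₂ * x₃ * x₄ * y₁ * y₂ * y₃)), ← hW]
  field_simp
  ring
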